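/- arXiv:2510.00146 — 3 statements merged into one kernel-verified Lean document; each statement's English description precedes it below -/
import Mathlib

section
/- Let n ≥ 1 and p = 2. Let u ∈ C²(ℝⁿ₊) ∩ C(cl ℝⁿ₊) be a classical solution of -Δu = |∇u|² in ℝⁿ₊ with u = 0 on ∂ℝⁿ₊. Then there exists a constant λ ≥ 0 such that e^{u(x)} = 1 + λ xₙ for all x in the closed half-space. -/
/-- The classical Laplacian of `u : ℝⁿ → ℝ`: the sum of the pure second
derivatives `∂²u/∂xᵢ²`. -/
noncomputable def laplacian {n : ℕ} (u : EuclideanSpace ℝ (Fin n) → ℝ)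
    (x : EuclideanSpace ℝ (Fin n)) : ℝ :=
  ∑ i, iteratedFDeriv ℝ 2 u x ![EuclideanSpace.single i 1, EuclideanSpace.single i 1]

/-- The open half-space `ℝⁿ₊ = {x ∈ ℝⁿ : xₙ > 0}` (dimension `n + 1`, so `n + 1 ≥ 1`). -/
def halfSpace (n : ℕ) : Set (EuclideanSpace ℝ (Fin (n + 1))) :=
  {x | 0 < x (Fin.last n)}

section Aux

open MeasureTheory Set Filter Topology

/-- Directional derivative. -/
noncomputable def dirD {m : ℕ} (v : EuclideanSpace ℝ (Fin m)) (F : EuclideanSpace ℝ (Fin m) → ℝ) :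
    EuclideanSpace ℝ (Fin m) → ℝ := fun z => fderiv ℝ F z v

/-- Laplacian via directional derivatives. -/
noncomputable def lapD {m : ℕ} (F : EuclideanSpace ℝ (Fin m) → ℝ) :
    EuclideanSpace ℝ (Fin m) → ℝ :=
  fun z => ∑ i, dirD (EuclideanSpace.single i 1) (dirD (EuclideanSpace.single i 1) F) z

lemma dirD_contDiff {m : ℕ} {F : EuclideanSpace ℝ (Fin m) → ℝ} (hF : ContDiff ℝ 2 F)
    (v : EuclideanSpace ℝ (Fin m)) : ContDiff ℝ 1 (dirD v F) := by
  have h : ContDiff ℝ 1 (fderiv ℝ F) := hF.fderiv_right (by norm_num)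
  exact h.clm_apply contDiff_const

lemma dirD_continuous {m : ℕ} {F : EuclideanSpace ℝ (Fin m) → ℝ} (hF : ContDiff ℝ 1 F)
    (v : EuclideanSpace ℝ (Fin m)) : Continuous (dirD v F) :=
  (hF.continuous_fderiv (by norm_num)).clm_apply continuous_const

lemma dirD_hcs {m : ℕ} {F : EuclideanSpace ℝ (Fin m) → ℝ} (hF : HasCompactSupport F)
    (v : EuclideanSpace ℝ (Fin m)) : HasCompactSupport (dirD v F) :=
  hF.fderiv_apply ℝ v

lemma dirD_mul {m : ℕ} {A B : EuclideanSpace ℝ (Fin m) → ℝ} {z : EuclideanSpace ℝ (Fin m)}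
    (hA : DifferentiableAt ℝ A z) (hB : DifferentiableAt ℝ B z) (v : EuclideanSpace ℝ (Fin m)) :
    dirD v (fun y => A y * B y) z = A z * dirD v B z + dirD v A z * B z := by
  unfold dirD
  rw [fderiv_fun_mul hA hB]
  simp [mul_comm]

lemma dirD_add {m : ℕ} {A B : EuclideanSpace ℝ (Fin m) → ℝ} {z : EuclideanSpace ℝ (Fin m)}
    (hA : DifferentiableAt ℝ A z) (hB : DifferentiableAt ℝ B z) (v : EuclideanSpace ℝ (Fin m)) :
    dirD v (fun y => A y + B y) z = dirD v A z + dirD v B z := by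
  unfold dirD
  rw [fderiv_fun_add hA hB]
  simp

lemma dirD_sub {m : ℕ} {A B : EuclideanSpace ℝ (Fin m) → ℝ} {z : EuclideanSpace ℝ (Fin m)}
    (hA : DifferentiableAt ℝ A z) (hB : DifferentiableAt ℝ B z) (v : EuclideanSpace ℝ (Fin m)) :
    dirD v (fun y => A y - B y) z = dirD v A z - dirD v B z := by
  unfold dirD
  rw [fderiv_fun_sub hA hB]
  simp

lemma dirD2_mul {m : ℕ} {A B : EuclideanSpace ℝ (Fin m) → ℝ} (hA : ContDiff ℝ 2 A)
    (hB : ContDiff ℝ 2 B) (v z : EuclideanSpace ℝ (Fin m)) :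
    dirD v (dirD v (fun y => A y * B y)) z =
      A z * dirD v (dirD v B) z + 2 * dirD v A z * dirD v B z + dirD v (dirD v A) z * B z := by
  have dA : Differentiable ℝ A := hA.differentiable (by norm_num)
  have dB : Differentiable ℝ B := hB.differentiable (by norm_num)
  have dA' : Differentiable ℝ (dirD v A) := (dirD_contDiff hA v).differentiable (by norm_num)
  have dB' : Differentiable ℝ (dirD v B) := (dirD_contDiff hB v).differentiable (by norm_num)
  have h1 : dirD v (fun y => A y * B y) = fun y => A y * dirD v B y + dirD v A y * B y := by
    ext y; exact dirD_mul (dA y) (dB y) v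
  rw [h1, dirD_add ((dA z).fun_mul (dB' z)) ((dA' z).fun_mul (dB z)), dirD_mul (dA z) (dB' z),
    dirD_mul (dA' z) (dB z)]
  ring

lemma dirD2_sub {m : ℕ} {A B : EuclideanSpace ℝ (Fin m) → ℝ} (hA : ContDiff ℝ 2 A)
    (hB : ContDiff ℝ 2 B) (v z : EuclideanSpace ℝ (Fin m)) :
    dirD v (dirD v (fun y => A y - B y)) z =
      dirD v (dirD v A) z - dirD v (dirD v B) z := by
  have dA : Differentiable ℝ A := hA.differentiable (by norm_num)
  have dB : Differentiable ℝ B := hB.differentiable (by norm_num)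
  have dA' : Differentiable ℝ (dirD v A) := (dirD_contDiff hA v).differentiable (by norm_num)
  have dB' : Differentiable ℝ (dirD v B) := (dirD_contDiff hB v).differentiable (by norm_num)
  have h1 : dirD v (fun y => A y - B y) = fun y => dirD v A y - dirD v B y := by
    ext y; exact dirD_sub (dA y) (dB y) v
  rw [h1, dirD_sub (dA' z) (dB' z)]

lemma lapD_congr {m : ℕ} {A B : EuclideanSpace ℝ (Fin m) → ℝ} {z : EuclideanSpace ℝ (Fin m)}
    (h : A =ᶠ[𝓝 z] B) : lapD A z = lapD B z := by
  unfold lapD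
  refine Finset.sum_congr rfl fun i _ => ?_
  have h1 : dirD (EuclideanSpace.single i 1) A =ᶠ[𝓝 z] dirD (EuclideanSpace.single i 1) B := by
    filter_upwards [h.eventuallyEq_nhds] with y hy
    unfold dirD
    rw [hy.fderiv_eq]
  unfold dirD at *
  rw [h1.fderiv_eq]

lemma lapD_continuous {m : ℕ} {F : EuclideanSpace ℝ (Fin m) → ℝ} (hF : ContDiff ℝ 2 F) :
    Continuous (lapD F) := by
  unfold lapD
  exact continuous_finsetSum _ fun i _ => dirD_continuous (dirD_contDiff hF _) _

lemma lapD_hcs {m : ℕ} {F : EuclideanSpace ℝ (Fin m) → ℝ} (hF : HasCompactSupport F) :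
    HasCompactSupport (lapD F) := by
  rw [hasCompactSupport_iff_eventuallyEq] at *
  have h2 : ∀ᶠ z in coclosedCompact (EuclideanSpace ℝ (Fin m)), ∀ i,
      dirD (EuclideanSpace.single i 1) (dirD (EuclideanSpace.single i 1) F) z = 0 := by
    rw [eventually_all]
    intro i
    exact hasCompactSupport_iff_eventuallyEq.1
      (dirD_hcs (dirD_hcs (hasCompactSupport_iff_eventuallyEq.2 hF) _) _)
  filter_upwards [h2] with z hz
  simp [lapD, hz]

lemma integrable_mul_right {m : ℕ} {A B : EuclideanSpace ℝ (Fin m) → ℝ} (hA : Continuous A)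
    (hB : Continuous B) (hc : HasCompactSupport B) : Integrable (fun z => A z * B z) :=
  (hA.mul hB).integrable_of_hasCompactSupport hc.mul_left

lemma ibp1 {m : ℕ} {A B : EuclideanSpace ℝ (Fin m) → ℝ} (hA : ContDiff ℝ 1 A)
    (hB : ContDiff ℝ 1 B) (hc : HasCompactSupport B) (v : EuclideanSpace ℝ (Fin m)) :
    ∫ z, A z * dirD v B z = - ∫ z, dirD v A z * B z := by
  have := integral_smul_fderiv_eq_neg_fderiv_smul_of_integrable (𝕜 := ℝ)
    (μ := (volume : Measure (EuclideanSpace ℝ (Fin m)))) (f := A) (g := B) (v := v)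
    (integrable_mul_right (dirD_continuous hA v) hB.continuous hc)
    (integrable_mul_right hA.continuous (dirD_continuous hB v) (dirD_hcs hc v))
    (integrable_mul_right hA.continuous hB.continuous hc)
    (fun x _ => hA.differentiable (by norm_num) x) (fun x _ => hB.differentiable (by norm_num) x)
  simpa [dirD, smul_eq_mul] using this

lemma green_full {m : ℕ} {A B : EuclideanSpace ℝ (Fin m) → ℝ} (hA : ContDiff ℝ 2 A)
    (hB : ContDiff ℝ 2 B) (hc : HasCompactSupport B) :
    ∫ z, A z * lapD B z = ∫ z, lapD A z * B z := by
  unfold lapD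
  simp_rw [Finset.mul_sum, Finset.sum_mul]
  rw [integral_finsetSum, integral_finsetSum]
  · refine Finset.sum_congr rfl fun i _ => ?_
    rw [ibp1 (hA.of_le (by norm_num)) (dirD_contDiff hB _) (dirD_hcs hc _),
      ibp1 (dirD_contDiff hA _) (hB.of_le (by norm_num)) hc, neg_neg]
  · intro i _
    exact integrable_mul_right (dirD_continuous (dirD_contDiff hA _) _) hB.continuous hc
  · intro i _
    exact integrable_mul_right hA.continuous (dirD_continuous (dirD_contDiff hB _) _)
      (dirD_hcs (dirD_hcs hc _) _)

lemma volume_layer (n : ℕ) (M t : ℝ) (hM : 0 ≤ M) (ht : 0 ≤ t) :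
    (volume : Measure (EuclideanSpace ℝ (Fin (n + 1)))).real
      {z | ‖z‖ ≤ M ∧ 0 ≤ z (Fin.last n) ∧ z (Fin.last n) ≤ t} ≤ (2 * M) ^ n * t := by
  set a : Fin (n + 1) → ℝ := Fin.snoc (α := fun _ => ℝ) (fun _ => -M) 0
  set b : Fin (n + 1) → ℝ := Fin.snoc (α := fun _ => ℝ) (fun _ => M) t
  have hab : a ≤ b := by
    intro i
    refine Fin.lastCases ?_ (fun j => ?_) i
    · simpa [a, b] using ht
    · simp [a, b]; linarith
  have hsub : {z : EuclideanSpace ℝ (Fin (n + 1)) |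
      ‖z‖ ≤ M ∧ 0 ≤ z (Fin.last n) ∧ z (Fin.last n) ≤ t} ⊆
      (WithLp.ofLp : EuclideanSpace ℝ (Fin (n + 1)) → _) ⁻¹' (Icc a b) := by
    rintro z ⟨h1, h2, h3⟩
    have hz : ∀ i, |z i| ≤ M := fun i => (PiLp.norm_apply_le z i).trans h1
    refine ⟨fun i => ?_, fun i => ?_⟩
    · refine Fin.lastCases ?_ (fun j => ?_) i
      · simpa [a] using h2
      · simpa [a] using (abs_le.1 (hz j.castSucc)).1
    · refine Fin.lastCases ?_ (fun j => ?_) i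
      · simpa [b] using h3
      · simpa [b] using (abs_le.1 (hz j.castSucc)).2
  have hp := (PiLp.volume_preserving_ofLp (Fin (n + 1))).measure_preimage
    (s := Icc a b) measurableSet_Icc.nullMeasurableSet
  have hv : (volume : Measure (Fin (n + 1) → ℝ)).real (Icc a b) = (2 * M) ^ n * t := by
    rw [Measure.real, Real.volume_Icc_pi_toReal hab, Fin.prod_univ_castSucc]
    simp [a, b, two_mul]
  rw [← hv]
  unfold Measure.real
  rw [← hp]
  refine ENNReal.toReal_mono ?_ (measure_mono hsub)
  rw [hp, Real.volume_Icc_pi]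
  exact ENNReal.prod_ne_top fun i _ => ENNReal.ofReal_ne_top


/-- A smooth cutoff on the line. -/
noncomputable def tauC (t : ℝ) : ℝ := Real.smoothTransition (t - 1)

lemma tauC_contDiff : ContDiff ℝ 2 tauC :=
  (Real.smoothTransition.contDiff (n := 2)).comp (contDiff_id.sub contDiff_const)

lemma tauC_zero {t : ℝ} (h : t ≤ 1) : tauC t = 0 :=
  Real.smoothTransition.zero_of_nonpos (by linarith)

lemma tauC_one {t : ℝ} (h : 2 ≤ t) : tauC t = 1 :=
  Real.smoothTransition.one_of_one_le (by linarith)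

lemma tauC_abs (t : ℝ) : |tauC t| ≤ 1 := by
  unfold tauC
  rw [abs_of_nonneg (Real.smoothTransition.nonneg _)]
  exact Real.smoothTransition.le_one _

lemma deriv_tauC_zero {t : ℝ} (h : t ∉ Icc (1 : ℝ) 2) : deriv tauC t = 0 := by
  rw [mem_Icc, not_and_or, not_le, not_le] at h
  rcases h with h | h
  · have : tauC =ᶠ[𝓝 t] fun _ => 0 := by
      filter_upwards [Iio_mem_nhds h] with s hs using tauC_zero (le_of_lt hs)
    rw [this.deriv_eq]; simp
  · have : tauC =ᶠ[𝓝 t] fun _ => 1 := by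
      filter_upwards [Ioi_mem_nhds h] with s hs using tauC_one (le_of_lt hs)
    rw [this.deriv_eq]; simp

lemma deriv2_tauC_zero {t : ℝ} (h : t ∉ Icc (1 : ℝ) 2) : deriv (deriv tauC) t = 0 := by
  have : deriv tauC =ᶠ[𝓝 t] fun _ => 0 := by
    filter_upwards [isClosed_Icc.isOpen_compl.mem_nhds h] with s hs using deriv_tauC_zero hs
  rw [this.deriv_eq]; simp

lemma deriv_tauC_contDiff : ContDiff ℝ 1 (deriv tauC) := by
  have h := tauC_contDiff
  rw [show (2 : WithTop ℕ∞) = 1 + 1 by norm_num, contDiff_succ_iff_deriv] at h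
  exact h.2.2

lemma tauC_bounds : ∃ C : ℝ, 0 ≤ C ∧ ∀ t, |deriv tauC t| ≤ C ∧ |deriv (deriv tauC) t| ≤ C := by
  have h1 := deriv_tauC_contDiff
  obtain ⟨C1, hC1⟩ := h1.continuous.bounded_above_of_compact_support
    (HasCompactSupport.intro (isCompact_Icc (a := (1 : ℝ)) (b := 2)) fun t ht => deriv_tauC_zero ht)
  obtain ⟨C2, hC2⟩ := (h1.continuous_deriv (by norm_num)).bounded_above_of_compact_support
    (HasCompactSupport.intro (isCompact_Icc (a := (1 : ℝ)) (b := 2)) fun t ht => deriv2_tauC_zero ht)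
  refine ⟨max C1 C2, ?_, fun t => ⟨(hC1 t).trans (le_max_left _ _), (hC2 t).trans (le_max_right _ _)⟩⟩
  exact ((norm_nonneg _).trans (hC1 0)).trans (le_max_left _ _)

lemma coord_contDiff {n : ℕ} (ε : ℝ) {k : WithTop ℕ∞} :
    ContDiff ℝ k (fun z : EuclideanSpace ℝ (Fin (n + 1)) => z (Fin.last n) / ε) := by
  fun_prop

lemma dirD_coord {n : ℕ} (ε : ℝ) {g : ℝ → ℝ} (hg : Differentiable ℝ g)
    (v z : EuclideanSpace ℝ (Fin (n + 1))) :
    dirD v (fun z => g (z (Fin.last n) / ε)) z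
      = deriv g (z (Fin.last n) / ε) * (v (Fin.last n) / ε) := by
  unfold dirD
  have h1 : HasFDerivAt (fun z : EuclideanSpace ℝ (Fin (n + 1)) => z (Fin.last n) / ε)
      (ε⁻¹ • (EuclideanSpace.proj (Fin.last n) : EuclideanSpace ℝ (Fin (n + 1)) →L[ℝ] ℝ)) z := by
    have := (EuclideanSpace.proj (Fin.last n) :
      EuclideanSpace ℝ (Fin (n + 1)) →L[ℝ] ℝ).hasFDerivAt (x := z)
    have h2 := this.const_smul ε⁻¹
    refine h2.congr_of_eventuallyEq (Eventually.of_forall fun y => ?_)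
    simp [div_eq_inv_mul]
  have h3 := (hg (z (Fin.last n) / ε)).hasDerivAt.comp_hasFDerivAt z h1
  have h4 := h3.fderiv
  change fderiv ℝ (g ∘ fun z : EuclideanSpace ℝ (Fin (n + 1)) => z (Fin.last n) / ε) z v = _
  rw [h4]
  simp [div_eq_inv_mul]

/-- Cutoff in the half-space. -/
noncomputable def chiC (n : ℕ) (ε : ℝ) (z : EuclideanSpace ℝ (Fin (n + 1))) : ℝ :=
  tauC (z (Fin.last n) / ε)

lemma chiC_contDiff (n : ℕ) (ε : ℝ) : ContDiff ℝ 2 (chiC n ε) :=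
  tauC_contDiff.comp (coord_contDiff ε)

lemma chiC_dirD (n : ℕ) (ε : ℝ) (v z : EuclideanSpace ℝ (Fin (n + 1))) :
    dirD v (chiC n ε) z = deriv tauC (z (Fin.last n) / ε) * (v (Fin.last n) / ε) :=
  dirD_coord ε (tauC_contDiff.differentiable (by norm_num)) v z

lemma chiC_dirD2 (n : ℕ) (ε : ℝ) (v z : EuclideanSpace ℝ (Fin (n + 1))) :
    dirD v (dirD v (chiC n ε)) z
      = deriv (deriv tauC) (z (Fin.last n) / ε) * (v (Fin.last n) / ε) ^ 2 := by
  have h : dirD v (chiC n ε) = fun z =>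
      deriv tauC (z (Fin.last n) / ε) * (v (Fin.last n) / ε) := by
    ext z; exact chiC_dirD n ε v z
  have hd := deriv_tauC_contDiff.differentiable (by norm_num)
  rw [h, dirD_mul (A := fun z : EuclideanSpace ℝ (Fin (n + 1)) =>
      deriv tauC (z (Fin.last n) / ε)) (B := fun _ => v (Fin.last n) / ε)
      ((hd.comp ((coord_contDiff ε (k := 1)).differentiable (by norm_num))) z)
      (differentiableAt_const _), dirD_coord ε hd]
  simp [dirD]
  ring

lemma lapD_cut (n : ℕ) (ε : ℝ) {Ψ : EuclideanSpace ℝ (Fin (n + 1)) → ℝ} (hΨ : ContDiff ℝ 2 Ψ)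
    (z : EuclideanSpace ℝ (Fin (n + 1))) :
    lapD (fun y => chiC n ε y * Ψ y) z = chiC n ε z * lapD Ψ z +
      (2 * (deriv tauC (z (Fin.last n) / ε) / ε) *
          dirD (EuclideanSpace.single (Fin.last n) 1) Ψ z
        + deriv (deriv tauC) (z (Fin.last n) / ε) / ε ^ 2 * Ψ z) := by
  unfold lapD
  simp_rw [dirD2_mul (chiC_contDiff n ε) hΨ, chiC_dirD, chiC_dirD2]
  rw [Fin.sum_univ_castSucc, Fin.sum_univ_castSucc, mul_add, Finset.mul_sum]
  have h : ∀ j : Fin n, (EuclideanSpace.single j.castSucc (1 : ℝ) :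
      EuclideanSpace ℝ (Fin (n + 1))) (Fin.last n) = 0 := by
    intro j
    simp [(Fin.castSucc_ne_last j).symm]
  simp only [h]
  simp
  ring

lemma cut_contDiff {n : ℕ} {f : EuclideanSpace ℝ (Fin (n + 1)) → ℝ} {ε : ℝ} (hε : 0 < ε)
    (hf2 : ContDiffOn ℝ 2 f (halfSpace n)) : ContDiff ℝ 2 (fun z => chiC n ε z * f z) := by
  rw [contDiff_iff_contDiffAt]
  intro z
  have hcont : Continuous fun z : EuclideanSpace ℝ (Fin (n + 1)) => z (Fin.last n) := by fun_prop
  by_cases hz : 0 < z (Fin.last n)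
  · have ho : IsOpen (halfSpace n) := isOpen_lt continuous_const hcont
    exact (chiC_contDiff n ε).contDiffAt.mul (hf2.contDiffAt (ho.mem_nhds hz))
  · have : (fun z => chiC n ε z * f z) =ᶠ[𝓝 z] fun _ => 0 := by
      filter_upwards [(isOpen_lt hcont continuous_const).mem_nhds
        (show z (Fin.last n) < ε by linarith)] with y hy
      have : y (Fin.last n) / ε ≤ 1 := by
        rw [div_le_one hε]; exact le_of_lt hy
      simp [chiC, tauC_zero this]
    exact contDiffAt_const.congr_of_eventuallyEq this

lemma green_cut {n : ℕ} {f : EuclideanSpace ℝ (Fin (n + 1)) → ℝ}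
    (hf2 : ContDiffOn ℝ 2 f (halfSpace n)) (hlap : ∀ z ∈ halfSpace n, lapD f z = 0)
    {Ψ : EuclideanSpace ℝ (Fin (n + 1)) → ℝ} (hΨ : ContDiff ℝ 2 Ψ) (hc : HasCompactSupport Ψ)
    {ε : ℝ} (hε : 0 < ε) : ∫ z, f z * lapD (fun y => chiC n ε y * Ψ y) z = 0 := by
  have hcont : Continuous fun z : EuclideanSpace ℝ (Fin (n + 1)) => z (Fin.last n) := by fun_prop
  have h1 : ∀ z, f z * lapD (fun y => chiC n ε y * Ψ y) z =
      (chiC n (ε / 2) z * f z) * lapD (fun y => chiC n ε y * Ψ y) z := by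
    intro z
    by_cases hz : z (Fin.last n) < ε
    · have : (fun z => chiC n ε z * Ψ z) =ᶠ[𝓝 z] fun _ => 0 := by
        filter_upwards [(isOpen_lt hcont continuous_const).mem_nhds hz] with y hy
        have : y (Fin.last n) / ε ≤ 1 := by
          rw [div_le_one hε]; exact le_of_lt hy
        simp [chiC, tauC_zero this]
      rw [lapD_congr this]
      have hz0 : lapD (fun _ : EuclideanSpace ℝ (Fin (n + 1)) => (0 : ℝ)) z = 0 := by
        have hh : ∀ v : EuclideanSpace ℝ (Fin (n + 1)),
            dirD v (fun _ : EuclideanSpace ℝ (Fin (n + 1)) => (0 : ℝ)) = fun _ => 0 := by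
          intro v; ext y; simp [dirD]
        simp [lapD, hh]
      rw [hz0, mul_zero, mul_zero]
    · have : 2 ≤ z (Fin.last n) / (ε / 2) := by
        rw [le_div_iff₀ (by linarith)]; linarith
      simp [chiC, tauC_one this]
  simp_rw [h1]
  rw [green_full (cut_contDiff (half_pos hε) hf2) ((chiC_contDiff n ε).mul hΨ) hc.mul_left]
  have h2 : ∀ z, lapD (fun z => chiC n (ε / 2) z * f z) z * (chiC n ε z * Ψ z) = 0 := by
    intro z
    by_cases hz : z (Fin.last n) ≤ ε
    · have : z (Fin.last n) / ε ≤ 1 := by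
        rw [div_le_one hε]; exact hz
      simp [chiC, tauC_zero this]
    · have hz' : ε < z (Fin.last n) := not_le.1 hz
      have : (fun z => chiC n (ε / 2) z * f z) =ᶠ[𝓝 z] f := by
        filter_upwards [(isOpen_lt continuous_const hcont).mem_nhds hz'] with y hy
        have hy' : ε < y (Fin.last n) := hy
        have : 2 ≤ y (Fin.last n) / (ε / 2) := by
          rw [le_div_iff₀ (by linarith)]; linarith
        simp [chiC, tauC_one this]
      rw [lapD_congr this, hlap z (show 0 < z (Fin.last n) by linarith)]
      simp
  simp [h2]

lemma green_half {n : ℕ} {f : EuclideanSpace ℝ (Fin (n + 1)) → ℝ} (hf : Continuous f)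
    (hf0 : ∀ z, z (Fin.last n) ≤ 0 → f z = 0)
    (hf2 : ContDiffOn ℝ 2 f (halfSpace n)) (hlap : ∀ z ∈ halfSpace n, lapD f z = 0)
    {Ψ : EuclideanSpace ℝ (Fin (n + 1)) → ℝ} (hΨ : ContDiff ℝ 2 Ψ) (hc : HasCompactSupport Ψ)
    (h0 : ∀ z, z (Fin.last n) = 0 → Ψ z = 0) : ∫ z, f z * lapD Ψ z = 0 := by
  set e : EuclideanSpace ℝ (Fin (n + 1)) := EuclideanSpace.single (Fin.last n) 1 with he
  have henorm : ‖e‖ = 1 := by simp [he]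
  have hcont : Continuous fun z : EuclideanSpace ℝ (Fin (n + 1)) => z (Fin.last n) := by fun_prop
  obtain ⟨C, hC0, hC⟩ := tauC_bounds
  obtain ⟨C1, hC1⟩ := (hΨ.continuous_fderiv (by norm_num)).bounded_above_of_compact_support
    (hc.fderiv ℝ)
  have hC10 : 0 ≤ C1 := (norm_nonneg _).trans (hC1 0)
  have hproj : ∀ z : EuclideanSpace ℝ (Fin (n + 1)), (z - z (Fin.last n) • e) (Fin.last n) = 0 := by
    intro z; simp [he]
  have hΨb : ∀ z, |Ψ z| ≤ C1 * |z (Fin.last n)| := by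
    intro z
    have := (convex_univ (𝕜 := ℝ)).norm_image_sub_le_of_norm_fderiv_le (f := Ψ) (C := C1)
      (fun x _ => hΨ.differentiable (by norm_num) x) (fun x _ => hC1 x)
      (mem_univ (z - z (Fin.last n) • e)) (mem_univ z)
    rw [h0 _ (hproj z)] at this
    simpa [norm_smul, henorm] using this
  have hDb : ∀ z, |dirD e Ψ z| ≤ C1 := by
    intro z
    have := (fderiv ℝ Ψ z).le_opNorm e
    rw [henorm, mul_one] at this
    exact this.trans (hC1 z)
  obtain ⟨M, hM0, hM⟩ : ∃ M : ℝ, 0 ≤ M ∧ ∀ z, M < ‖z‖ → Ψ z = 0 ∧ dirD e Ψ z = 0 := by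
    obtain ⟨M, hM⟩ := hc.isBounded.exists_norm_le
    refine ⟨max M 0, le_max_right _ _, fun z hz => ?_⟩
    have hz' : z ∉ tsupport Ψ := fun h => absurd (hM z h) (not_le.2 ((le_max_left _ _).trans_lt hz))
    refine ⟨image_eq_zero_of_notMem_tsupport hz', ?_⟩
    have : Ψ =ᶠ[𝓝 z] 0 := notMem_tsupport_iff_eventuallyEq.1 hz'
    unfold dirD
    rw [this.fderiv_eq]
    simp
  set E : ℝ → EuclideanSpace ℝ (Fin (n + 1)) → ℝ := fun ε z =>
      (2 * (deriv tauC (z (Fin.last n) / ε) / ε) * dirD e Ψ z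
        + deriv (deriv tauC) (z (Fin.last n) / ε) / ε ^ 2 * Ψ z) with hE
  have hEc : ∀ ε, Continuous (E ε) := by
    intro ε
    have a1 : Continuous (dirD e Ψ) := dirD_continuous (hΨ.of_le (by norm_num)) e
    have a2 := deriv_tauC_contDiff.continuous
    have a3 := deriv_tauC_contDiff.continuous_deriv (by norm_num)
    have a4 := hΨ.continuous
    have a5 := (coord_contDiff (n := n) ε (k := 1)).continuous
    have a6 := a2.comp a5
    have a7 := a3.comp a5
    exact ((continuous_const.mul (a6.div_const ε)).mul a1).add ((a7.div_const _).mul a4)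
  have hEs : ∀ ε, HasCompactSupport (E ε) := by
    intro ε
    refine HasCompactSupport.intro (isCompact_closedBall 0 M) fun z hz => ?_
    have : M < ‖z‖ := by simpa using hz
    simp [hE, (hM z this).1, (hM z this).2]
  have key : ∀ ε, 0 < ε → ∫ z, f z * (chiC n ε z * lapD Ψ z) = - ∫ z, f z * E ε z := by
    intro ε hε
    have h := green_cut hf2 hlap hΨ hc hε
    simp_rw [lapD_cut n ε hΨ, mul_add (f _) (chiC n ε _ * lapD Ψ _)] at h
    rw [integral_add] at h
    · linarith
    · exact integrable_mul_right hf ((chiC_contDiff n ε).continuous.mul (lapD_continuous hΨ))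
        (lapD_hcs hc).mul_left
    · exact integrable_mul_right hf (hEc ε) (hEs ε)
  have hEbound : ∀ ε, 0 < ε → ∀ z, |E ε z| ≤ 4 * C * C1 / ε := by
    intro ε hε z
    by_cases hz : z (Fin.last n) / ε ∈ Icc (1 : ℝ) 2
    · have hz2 : |z (Fin.last n)| ≤ 2 * ε := by
        have h1 := hz.1
        have h2 := hz.2
        rw [le_div_iff₀ hε] at h1
        rw [div_le_iff₀ hε] at h2
        rw [abs_of_nonneg (by linarith)]; exact h2
      have hb1 : |2 * (deriv tauC (z (Fin.last n) / ε) / ε) * dirD e Ψ z| ≤ 2 * (C / ε) * C1 := by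
        rw [abs_mul, abs_mul, abs_div, abs_of_pos hε, abs_two]
        gcongr
        · exact (hC _).1
        · exact hDb z
      have hb2 : |deriv (deriv tauC) (z (Fin.last n) / ε) / ε ^ 2 * Ψ z|
          ≤ C / ε ^ 2 * (C1 * (2 * ε)) := by
        rw [abs_mul, abs_div, abs_of_pos (pow_pos hε 2)]
        gcongr
        · exact (hC _).2
        · exact (hΨb z).trans (by gcongr)
      refine (abs_add_le _ _).trans ((add_le_add hb1 hb2).trans (le_of_eq ?_))
      field_simp
      ring
    · simp [hE, deriv_tauC_zero hz, deriv2_tauC_zero hz]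
      positivity
  have hEzero : ∀ ε, 0 < ε → ∀ z, ¬ (‖z‖ ≤ M ∧ 0 ≤ z (Fin.last n) ∧ z (Fin.last n) ≤ 2 * ε) →
      E ε z = 0 := by
    intro ε hε z hz
    by_cases h1 : M < ‖z‖
    · simp [hE, (hM z h1).1, (hM z h1).2]
    · have : z (Fin.last n) / ε ∉ Icc (1 : ℝ) 2 := by
        rintro ⟨h2, h3⟩
        rw [le_div_iff₀ hε] at h2
        rw [div_le_iff₀ hε] at h3
        exact hz ⟨not_lt.1 h1, by linarith, h3⟩
      simp [hE, deriv_tauC_zero this, deriv2_tauC_zero this]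
  -- smallness near the boundary
  have hsmall : ∀ δ > 0, ∃ η > 0, ∀ z : EuclideanSpace ℝ (Fin (n + 1)), ‖z‖ ≤ M →
      0 ≤ z (Fin.last n) → z (Fin.last n) < η → |f z| ≤ δ := by
    intro δ hδ
    have huc := (isCompact_closedBall (0 : EuclideanSpace ℝ (Fin (n + 1)))
      (2 * M)).uniformContinuousOn_of_continuous hf.continuousOn
    rw [Metric.uniformContinuousOn_iff] at huc
    obtain ⟨η, hη, h⟩ := huc δ hδ
    refine ⟨η, hη, fun z hz h1 h2 => ?_⟩
    have hzn : |z (Fin.last n)| ≤ M := (PiLp.norm_apply_le z (Fin.last n)).trans hz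
    have hd : dist z (z - z (Fin.last n) • e) = |z (Fin.last n)| := by
      rw [dist_eq_norm]; simp [norm_smul, henorm]
    have := h z (by simp; linarith) (z - z (Fin.last n) • e) (by
      have := norm_sub_le z (z (Fin.last n) • e)
      rw [norm_smul, henorm, mul_one, Real.norm_eq_abs] at this
      simp
      linarith) (by rw [hd, abs_of_nonneg h1]; exact h2)
    rw [hf0 (z - z (Fin.last n) • e) (hproj z).le, dist_eq_norm, sub_zero] at this
    exact this.le
  have hlim1 : Tendsto (fun k : ℕ => ∫ z, f z * (chiC n (1 / ((k : ℝ) + 1)) z * lapD Ψ z)) atTop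
      (𝓝 (∫ z, f z * lapD Ψ z)) := by
    refine tendsto_integral_of_dominated_convergence (fun z => |f z * lapD Ψ z|) ?_ ?_ ?_ ?_
    · intro k
      exact (hf.mul ((chiC_contDiff n _).continuous.mul (lapD_continuous hΨ))).aestronglyMeasurable
    · exact (integrable_mul_right hf (lapD_continuous hΨ) (lapD_hcs hc)).abs
    · intro k
      refine Eventually.of_forall fun z => ?_
      rw [Real.norm_eq_abs, abs_mul, abs_mul, abs_mul]
      have : |chiC n (1 / ((k : ℝ) + 1)) z| ≤ 1 := tauC_abs _
      have h3 := mul_le_mul_of_nonneg_right this (abs_nonneg (lapD Ψ z))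
      rw [one_mul] at h3
      exact mul_le_mul_of_nonneg_left h3 (abs_nonneg _)
    · refine Eventually.of_forall fun z => ?_
      by_cases hz : z (Fin.last n) ≤ 0
      · simp [hf0 z hz]
      · have hz' := not_le.1 hz
        have : ∀ᶠ k : ℕ in atTop, f z * (chiC n (1 / ((k : ℝ) + 1)) z * lapD Ψ z)
            = f z * lapD Ψ z := by
          obtain ⟨K, hK⟩ := exists_nat_gt (2 / z (Fin.last n))
          filter_upwards [eventually_ge_atTop K] with k hk
          have hk' : (K : ℝ) ≤ k := by exact_mod_cast hk
          have : 2 ≤ z (Fin.last n) / (1 / ((k : ℝ) + 1)) := by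
            rw [div_lt_iff₀ hz'] at hK
            rw [div_div_eq_mul_div, div_one]
            nlinarith
          rw [chiC, tauC_one this, one_mul]
        exact tendsto_const_nhds.congr' (this.mono fun k hk => hk.symm)
  have hlim2 : Tendsto (fun k : ℕ => ∫ z, f z * (chiC n (1 / ((k : ℝ) + 1)) z * lapD Ψ z)) atTop
      (𝓝 0) := by
    rw [Metric.tendsto_atTop]
    intro γ hγ
    set B : ℝ := 8 * C * C1 * (2 * M) ^ n with hB
    have hB0 : 0 ≤ B := by positivity
    obtain ⟨η, hη, hsm⟩ := hsmall (γ / (B + 1)) (by positivity)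
    obtain ⟨K, hK⟩ := exists_nat_gt (2 / η)
    refine ⟨K, fun k hk => ?_⟩
    have hk' : (K : ℝ) ≤ k := by exact_mod_cast hk
    set ε : ℝ := 1 / ((k : ℝ) + 1) with hεd
    have hε : 0 < ε := by positivity
    have hεη : 2 * ε < η := by
      rw [div_lt_iff₀ hη] at hK
      rw [hεd, mul_one_div, div_lt_iff₀ (by positivity)]
      nlinarith
    rw [key ε hε, dist_zero_right, norm_neg]
    set L : Set (EuclideanSpace ℝ (Fin (n + 1))) :=
      {z | ‖z‖ ≤ M ∧ 0 ≤ z (Fin.last n) ∧ z (Fin.last n) ≤ 2 * ε} with hL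
    rw [← setIntegral_eq_integral_of_forall_compl_eq_zero (s := L)
      (fun z hz => by rw [hEzero ε hε z hz, mul_zero])]
    have hfin : volume L < ⊤ := by
      refine (measure_mono (t := Metric.closedBall 0 M) fun z hz => ?_).trans_lt
        measure_closedBall_lt_top
      simpa using hz.1
    have hb := norm_setIntegral_le_of_norm_le_const (μ := volume) (s := L)
      (f := fun z => f z * E ε z) (C := γ / (B + 1) * (4 * C * C1 / ε)) hfin (fun z hz => by
        rw [Real.norm_eq_abs, abs_mul]
        have := hsm z hz.1 hz.2.1 (hz.2.2.trans_lt hεη)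
        have h5 := hEbound ε hε z
        gcongr)
    have hv := volume_layer n M (2 * ε) hM0 (by linarith)
    have : γ / (B + 1) * (4 * C * C1 / ε) * volume.real L ≤ γ / (B + 1) * B := by
      calc _ ≤ γ / (B + 1) * (4 * C * C1 / ε) * ((2 * M) ^ n * (2 * ε)) := by gcongr
        _ = γ / (B + 1) * B := by rw [hB]; field_simp; ring
    refine (hb.trans this).trans_lt ?_
    rw [div_mul_eq_mul_div, div_lt_iff₀ (by linarith)]
    nlinarith
  exact tendsto_nhds_unique hlim1 hlim2


lemma hasDerivAt_pp (k : ℕ) (s : ℝ) :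
    HasDerivAt (fun s : ℝ => (max s 0) ^ (k + 2)) ((k + 2 : ℕ) * (max s 0) ^ (k + 1)) s := by
  rcases lt_trichotomy s 0 with h | h | h
  · have : (fun s : ℝ => (max s 0) ^ (k + 2)) =ᶠ[𝓝 s] fun _ => 0 := by
      filter_upwards [Iio_mem_nhds h] with t ht
      rw [max_eq_right (le_of_lt ht)]; simp
    rw [max_eq_right h.le]
    simpa using (hasDerivAt_const s (0 : ℝ)).congr_of_eventuallyEq this
  · subst h
    have : (fun s : ℝ => (max s 0) ^ (k + 2)) =O[𝓝 0] fun s => ‖s - 0‖ ^ (k + 2) := by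
      refine Asymptotics.IsBigO.of_bound 1 (Eventually.of_forall fun t => ?_)
      rw [one_mul, sub_zero, norm_pow, norm_pow, norm_norm]
      gcongr
      rw [Real.norm_eq_abs, Real.norm_eq_abs, abs_of_nonneg (le_max_right _ _)]
      exact max_le (le_abs_self _) (abs_nonneg _)
    have := (this.hasFDerivAt (by omega)).hasDerivAt
    simpa using this
  · have : (fun s : ℝ => (max s 0) ^ (k + 2)) =ᶠ[𝓝 s] fun s => s ^ (k + 2) := by
      filter_upwards [Ioi_mem_nhds h] with t ht
      rw [max_eq_left (le_of_lt ht)]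
    rw [max_eq_left h.le]
    exact (hasDerivAt_pow (k + 2) s).congr_of_eventuallyEq this

lemma contDiff_pp3 : ContDiff ℝ 2 (fun s : ℝ => (max s 0) ^ 3) := by
  have h1 : deriv (fun s : ℝ => (max s 0) ^ 3) = fun s => 3 * (max s 0) ^ 2 := by
    ext s; simpa using (hasDerivAt_pp 1 s).deriv
  have h2 : deriv (fun s : ℝ => (max s 0) ^ 2) = fun s => 2 * (max s 0) := by
    ext s; simpa using (hasDerivAt_pp 0 s).deriv
  have h3 : ContDiff ℝ 1 (fun s : ℝ => (max s 0) ^ 2) := by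
    rw [contDiff_one_iff_deriv]
    refine ⟨fun s => (hasDerivAt_pp 0 s).differentiableAt, ?_⟩
    rw [h2]; fun_prop
  rw [show (2 : WithTop ℕ∞) = 1 + 1 by norm_num, contDiff_succ_iff_deriv]
  refine ⟨fun s => (hasDerivAt_pp 1 s).differentiableAt, by simp, ?_⟩
  rw [h1]
  exact contDiff_const.mul h3

/-- The radial kernels. -/
noncomputable def phiK {m : ℕ} (k : ℕ) (r : ℝ) (x z : EuclideanSpace ℝ (Fin m)) : ℝ :=
  (max (r ^ 2 - ‖z - x‖ ^ 2) 0) ^ k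

lemma phiK_nonneg {m : ℕ} (k : ℕ) (r : ℝ) (x z : EuclideanSpace ℝ (Fin m)) : 0 ≤ phiK k r x z :=
  pow_nonneg (le_max_right _ _) _

lemma phiK_continuous {m : ℕ} (k : ℕ) (r : ℝ) (x : EuclideanSpace ℝ (Fin m)) :
    Continuous (phiK k r x) := by
  unfold phiK; fun_prop

lemma phiK_zero {m : ℕ} {k : ℕ} (hk : k ≠ 0) {r : ℝ} {x z : EuclideanSpace ℝ (Fin m)}
    (h : |r| ≤ ‖z - x‖) : phiK k r x z = 0 := by
  have : r ^ 2 ≤ ‖z - x‖ ^ 2 := sq_le_sq.2 (by rwa [abs_of_nonneg (norm_nonneg (z - x))])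
  unfold phiK
  rw [max_eq_right (by linarith), zero_pow hk]

lemma phiK_hcs {m : ℕ} {k : ℕ} (hk : k ≠ 0) (r : ℝ) (x : EuclideanSpace ℝ (Fin m)) :
    HasCompactSupport (phiK k r x) := by
  refine HasCompactSupport.intro (isCompact_closedBall x |r|) fun z hz => phiK_zero hk ?_
  rw [Metric.mem_closedBall, dist_eq_norm, not_le] at hz
  exact hz.le

lemma phiK_contDiff {m : ℕ} (r : ℝ) (x : EuclideanSpace ℝ (Fin m)) :
    ContDiff ℝ 2 (phiK 3 r x) := by
  unfold phiK
  exact contDiff_pp3.comp (contDiff_const.sub ((contDiff_id.sub contDiff_const).norm_sq ℝ))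

lemma phiK_dirD {m : ℕ} (k : ℕ) (r : ℝ) (x v z : EuclideanSpace ℝ (Fin m)) :
    HasFDerivAt (phiK (k + 2) r x)
      (((k + 2 : ℕ) * phiK (k + 1) r x z) •
        (-(2 • (innerSL ℝ (z - x))) : EuclideanSpace ℝ (Fin m) →L[ℝ] ℝ)) z := by
  have h1 : HasFDerivAt (fun z => r ^ 2 - ‖z - x‖ ^ 2) (-(2 • (innerSL ℝ (z - x)))) z := by
    have := (((hasStrictFDerivAt_norm_sq (z - x)).hasFDerivAt).comp z
      ((hasFDerivAt_id z).sub_const x)).const_sub (r ^ 2)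
    simpa using this
  exact (hasDerivAt_pp k _).comp_hasFDerivAt z h1

lemma phiK_dirD_eq {m : ℕ} (k : ℕ) (r : ℝ) (x v z : EuclideanSpace ℝ (Fin m)) :
    dirD v (phiK (k + 2) r x) z = -(2 * (k + 2 : ℕ)) * phiK (k + 1) r x z * inner ℝ (z - x) v := by
  unfold dirD
  rw [(phiK_dirD k r x v z).fderiv]
  simp [inner_sub_left]
  ring

lemma phiK_dirD2 {m : ℕ} (r : ℝ) (x v z : EuclideanSpace ℝ (Fin m)) :
    dirD v (dirD v (phiK 3 r x)) z =
      24 * phiK 1 r x z * (inner ℝ (z - x) v) ^ 2 - 6 * phiK 2 r x z * ‖v‖ ^ 2 := by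
  have h : dirD v (phiK 3 r x) = fun z => phiK 2 r x z * (-6 * inner ℝ (z - x) v) := by
    ext y
    rw [phiK_dirD_eq 1 r x v y]
    norm_num
    ring
  have h1 : HasFDerivAt (fun z => -6 * inner ℝ (z - x) v) (-6 • (innerSL ℝ v)) z := by
    have := (((innerSL ℝ v).hasFDerivAt (x := z - x)).comp z
      ((hasFDerivAt_id z).sub_const x)).const_smul (-6 : ℝ)
    refine (this.congr_of_eventuallyEq (Eventually.of_forall fun y => ?_)).congr_fderiv ?_
    · simp [real_inner_comm]
    · ext y; simp
  rw [h, dirD_mul (phiK_dirD 0 r x v z).differentiableAt h1.differentiableAt,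
    phiK_dirD_eq 0 r x v z]
  unfold dirD
  rw [h1.fderiv]
  simp
  ring

lemma phiK_lapD {m : ℕ} (r : ℝ) (x z : EuclideanSpace ℝ (Fin m)) :
    lapD (phiK 3 r x) z = 24 * r ^ 2 * phiK 1 r x z - (24 + 6 * m) * phiK 2 r x z := by
  unfold lapD
  simp_rw [phiK_dirD2]
  rw [Finset.sum_sub_distrib, ← Finset.mul_sum]
  have h1 : ∑ i, (inner ℝ (z - x) (EuclideanSpace.single i (1 : ℝ))) ^ 2 = ‖z - x‖ ^ 2 := by
    rw [EuclideanSpace.real_norm_sq_eq]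
    simp [EuclideanSpace.inner_single_right]
  have h2 : ‖z - x‖ ^ 2 * phiK 1 r x z = r ^ 2 * phiK 1 r x z - phiK 2 r x z := by
    unfold phiK
    rcases le_total (r ^ 2 - ‖z - x‖ ^ 2) 0 with h | h
    · rw [max_eq_right h]; simp
    · rw [max_eq_left h]; ring
  rw [h1]
  simp
  linear_combination 24 * h2

/-- Reflection across the boundary. -/
noncomputable def reflK {n : ℕ} (x : EuclideanSpace ℝ (Fin (n + 1))) :
    EuclideanSpace ℝ (Fin (n + 1)) :=
  x - (2 * x (Fin.last n)) • EuclideanSpace.single (Fin.last n) 1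

lemma inner_reflK {n : ℕ} (x z : EuclideanSpace ℝ (Fin (n + 1))) :
    inner ℝ z (reflK x) = inner ℝ z x - 2 * x (Fin.last n) * z (Fin.last n) := by
  unfold reflK
  rw [inner_sub_right, inner_smul_right, EuclideanSpace.inner_single_right]
  simp

lemma norm_reflK {n : ℕ} (x : EuclideanSpace ℝ (Fin (n + 1))) : ‖reflK x‖ = ‖x‖ := by
  have : ‖reflK x‖ ^ 2 = ‖x‖ ^ 2 := by
    rw [← real_inner_self_eq_norm_sq, inner_reflK, real_inner_comm, inner_reflK]
    simp [reflK]
    ring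
  exact (sq_eq_sq₀ (norm_nonneg _) (norm_nonneg _)).1 this

lemma norm_sub_reflK {n : ℕ} (x z : EuclideanSpace ℝ (Fin (n + 1))) :
    ‖z - reflK x‖ ^ 2 = ‖z - x‖ ^ 2 + 4 * x (Fin.last n) * z (Fin.last n) := by
  rw [norm_sub_sq_real, norm_sub_sq_real, norm_reflK, inner_reflK]
  ring

/-- The odd kernel. -/
noncomputable def oddK {n : ℕ} (k : ℕ) (r : ℝ) (x z : EuclideanSpace ℝ (Fin (n + 1))) : ℝ :=
  phiK k r x z - phiK k r (reflK x) z

lemma oddK_continuous {n : ℕ} (k : ℕ) (r : ℝ) (x : EuclideanSpace ℝ (Fin (n + 1))) :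
    Continuous (oddK k r x) := (phiK_continuous _ _ _).sub (phiK_continuous _ _ _)

lemma oddK_hcs {n : ℕ} {k : ℕ} (hk : k ≠ 0) (r : ℝ) (x : EuclideanSpace ℝ (Fin (n + 1))) :
    HasCompactSupport (oddK k r x) := (phiK_hcs hk r x).sub (phiK_hcs hk r (reflK x))

lemma oddK_green {n : ℕ} {f : EuclideanSpace ℝ (Fin (n + 1)) → ℝ} (hf : Continuous f)
    (hf0 : ∀ z, z (Fin.last n) ≤ 0 → f z = 0)
    (hf2 : ContDiffOn ℝ 2 f (halfSpace n)) (hlap : ∀ z ∈ halfSpace n, lapD f z = 0)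
    (r : ℝ) (x : EuclideanSpace ℝ (Fin (n + 1))) :
    4 * r ^ 2 * ∫ z, f z * oddK 1 r x z = (n + 5) * ∫ z, f z * oddK 2 r x z := by
  have h := green_half hf hf0 hf2 hlap (Ψ := oddK 3 r x)
    ((phiK_contDiff r x).sub (phiK_contDiff r (reflK x))) (oddK_hcs (by norm_num) r x)
    (fun z hz => by
      unfold oddK phiK
      rw [norm_sub_reflK, hz]; simp)
  have h1 : ∀ z, f z * lapD (oddK 3 r x) z
      = 24 * r ^ 2 * (f z * oddK 1 r x z) - (24 + 6 * (n + 1)) * (f z * oddK 2 r x z) := by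
    intro z
    have : lapD (oddK 3 r x) z = lapD (phiK 3 r x) z - lapD (phiK 3 r (reflK x)) z := by
      unfold lapD
      rw [← Finset.sum_sub_distrib]
      exact Finset.sum_congr rfl fun i _ => dirD2_sub (phiK_contDiff r x) (phiK_contDiff r _) _ z
    rw [this, phiK_lapD, phiK_lapD]
    unfold oddK
    push_cast
    ring
  simp_rw [h1] at h
  rw [integral_sub, integral_const_mul, integral_const_mul] at h
  · linarith
  · exact (integrable_mul_right hf (oddK_continuous 1 r x) (oddK_hcs (by norm_num) r x)).const_mul _
  · exact (integrable_mul_right hf (oddK_continuous 2 r x) (oddK_hcs (by norm_num) r x)).const_mul _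

lemma phiK_mono {m : ℕ} (k : ℕ) {r R : ℝ} (h : |r| ≤ R) (x z : EuclideanSpace ℝ (Fin m)) :
    phiK k r x z ≤ phiK k R x z := by
  unfold phiK
  have : r ^ 2 ≤ R ^ 2 := sq_le_sq.2 (h.trans (le_abs_self R))
  gcongr

lemma phiK_hasDerivAt_r {m : ℕ} (t : ℝ) (x z : EuclideanSpace ℝ (Fin m)) :
    HasDerivAt (fun t => phiK 2 t x z) (4 * t * phiK 1 t x z) t := by
  have h1 : HasDerivAt (fun t : ℝ => t ^ 2 - ‖z - x‖ ^ 2) (2 * t) t := by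
    simpa using (hasDerivAt_pow 2 t).sub_const (‖z - x‖ ^ 2)
  have h2 := (hasDerivAt_pp 0 _).comp t h1
  refine h2.congr_deriv ?_
  unfold phiK
  norm_num
  ring

lemma phiK_integral_deriv {m : ℕ} {f : EuclideanSpace ℝ (Fin m) → ℝ} (hf : Continuous f)
    {r : ℝ} (hr : 0 < r) (x : EuclideanSpace ℝ (Fin m)) :
    HasDerivAt (fun t => ∫ z, f z * phiK 2 t x z) (4 * r * ∫ z, f z * phiK 1 r x z) r := by
  have h := hasDerivAt_integral_of_dominated_loc_of_deriv_le
    (μ := (volume : Measure (EuclideanSpace ℝ (Fin m)))) (F := fun t z => f z * phiK 2 t x z)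
    (F' := fun t z => f z * (4 * t * phiK 1 t x z)) (x₀ := r)
    (bound := fun z => |f z| * (4 * (r + 1) * phiK 1 (r + 1) x z))
    (Metric.ball_mem_nhds r one_pos)
    (Eventually.of_forall fun t => (hf.mul (phiK_continuous 2 t x)).aestronglyMeasurable)
    (integrable_mul_right hf (phiK_continuous 2 r x) (phiK_hcs (by norm_num) r x))
    (hf.mul (continuous_const.mul (phiK_continuous 1 r x))).aestronglyMeasurable
    (Eventually.of_forall fun z t ht => ?_)
    (integrable_mul_right hf.abs (continuous_const.mul (phiK_continuous 1 (r + 1) x))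
      (phiK_hcs (by norm_num) (r + 1) x).mul_left)
    (Eventually.of_forall fun z t ht => (phiK_hasDerivAt_r t x z).const_mul _)
  · refine h.2.congr_deriv ?_
    rw [← integral_const_mul]
    congr 1
    ext z
    ring
  · have ht' : |t| ≤ r + 1 := by
      rw [Metric.mem_ball, Real.dist_eq, abs_lt] at ht
      rw [abs_le]
      constructor <;> linarith [ht.1, ht.2]
    rw [Real.norm_eq_abs, abs_mul, abs_mul, abs_mul, abs_of_nonneg (phiK_nonneg 1 t x z)]
    have := phiK_mono 1 ht' x z
    have h4 : |(4 : ℝ)| = 4 := by norm_num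
    rw [h4]
    have := phiK_nonneg 1 t x z
    gcongr

lemma oddK_integral {n : ℕ} {f : EuclideanSpace ℝ (Fin (n + 1)) → ℝ} (hf : Continuous f)
    {k : ℕ} (hk : k ≠ 0) (r : ℝ) (x : EuclideanSpace ℝ (Fin (n + 1))) :
    ∫ z, f z * oddK k r x z = (∫ z, f z * phiK k r x z) - ∫ z, f z * phiK k r (reflK x) z := by
  unfold oddK
  simp_rw [mul_sub]
  exact integral_sub (integrable_mul_right hf (phiK_continuous k r x) (phiK_hcs hk r x))
    (integrable_mul_right hf (phiK_continuous k r _) (phiK_hcs hk r _))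

lemma oddK_const {n : ℕ} {f : EuclideanSpace ℝ (Fin (n + 1)) → ℝ} (hf : Continuous f)
    (hf0 : ∀ z, z (Fin.last n) ≤ 0 → f z = 0)
    (hf2 : ContDiffOn ℝ 2 f (halfSpace n)) (hlap : ∀ z ∈ halfSpace n, lapD f z = 0)
    (x : EuclideanSpace ℝ (Fin (n + 1))) :
    ∃ L : ℝ, ∀ r > 0, ∫ z, f z * oddK 2 r x z = L * r ^ (n + 5) := by
  have hd : ∀ r > 0, HasDerivAt (fun r => (∫ z, f z * oddK 2 r x z) / r ^ (n + 5)) 0 r := by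
    intro r hr
    have h1 : HasDerivAt (fun r => ∫ z, f z * oddK 2 r x z)
        (4 * r * ∫ z, f z * oddK 1 r x z) r := by
      simp_rw [oddK_integral hf two_ne_zero, oddK_integral hf one_ne_zero, mul_sub]
      exact (phiK_integral_deriv hf hr x).sub (phiK_integral_deriv hf hr _)
    have h2 := h1.div (hasDerivAt_pow (n + 5) r) (pow_ne_zero _ hr.ne')
    refine h2.congr_deriv ?_
    have hg := oddK_green hf hf0 hf2 hlap r x
    have hnum : (4 * r * ∫ z, f z * oddK 1 r x z) * r ^ (n + 5)
        - (∫ z, f z * oddK 2 r x z) * (((n + 5 : ℕ) : ℝ) * r ^ (n + 5 - 1)) = 0 := by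
      rw [show n + 5 - 1 = n + 4 by omega]
      push_cast
      linear_combination r ^ (n + 4) * hg
    rw [hnum, zero_div]
  obtain ⟨L, hL⟩ := isOpen_Ioi.exists_is_const_of_deriv_eq_zero (s := Ioi (0 : ℝ))
    (convex_Ioi (0 : ℝ)).isPreconnected
    (fun r hr => (hd r hr).differentiableAt.differentiableWithinAt) (fun r hr => (hd r hr).deriv)
  refine ⟨L, fun r hr => ?_⟩
  have := hL r hr
  rwa [div_eq_iff (pow_ne_zero _ (ne_of_gt hr))] at this

/-- The normalizing constant. -/
noncomputable def cK (n : ℕ) : ℝ := ∫ z : EuclideanSpace ℝ (Fin (n + 1)), phiK 2 1 0 z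

lemma cK_pos (n : ℕ) : 0 < cK n := by
  refine (phiK_continuous 2 1 0).integral_pos_of_hasCompactSupport_nonneg_nonzero
    (phiK_hcs (by norm_num) 1 0) (fun z => phiK_nonneg 2 1 0 z) (x := 0) ?_
  simp [phiK]

lemma phiK_scale {n : ℕ} {r : ℝ} (hr : 0 < r) (x : EuclideanSpace ℝ (Fin (n + 1))) :
    ∫ z, phiK 2 r x z = cK n * r ^ (n + 5) := by
  have h1 : ∫ z, phiK 2 r x z = ∫ z : EuclideanSpace ℝ (Fin (n + 1)), phiK 2 r 0 z := by
    rw [← integral_sub_right_eq_self (fun z => phiK 2 r 0 z) x]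
    simp [phiK]
  have h2 := Measure.integral_comp_smul (volume : Measure (EuclideanSpace ℝ (Fin (n + 1))))
    (fun z => phiK 2 r 0 z) r
  have h3 : ∀ z : EuclideanSpace ℝ (Fin (n + 1)), phiK 2 r 0 (r • z) = r ^ 4 * phiK 2 1 0 z := by
    intro z
    unfold phiK
    rw [sub_zero, sub_zero, norm_smul, Real.norm_eq_abs, mul_pow, sq_abs]
    have : max (r ^ 2 - r ^ 2 * ‖z‖ ^ 2) 0 = r ^ 2 * max (1 ^ 2 - ‖z‖ ^ 2) 0 := by
      rw [mul_max_of_nonneg _ _ (sq_nonneg r)]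
      congr 1 <;> ring
    rw [this]; ring
  simp_rw [h3] at h2
  rw [integral_const_mul, finrank_euclideanSpace_fin, abs_of_pos (by positivity), smul_eq_mul,
    ← div_eq_inv_mul, eq_div_iff (by positivity)] at h2
  rw [h1, ← h2]
  unfold cK
  ring

lemma mean_value {n : ℕ} {f : EuclideanSpace ℝ (Fin (n + 1)) → ℝ} (hf : Continuous f)
    (hf0 : ∀ z, z (Fin.last n) ≤ 0 → f z = 0)
    (hf2 : ContDiffOn ℝ 2 f (halfSpace n)) (hlap : ∀ z ∈ halfSpace n, lapD f z = 0)
    {x : EuclideanSpace ℝ (Fin (n + 1))} (hx : x ∈ halfSpace n) {r : ℝ} (hr : 0 < r) :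
    ∫ z, f z * oddK 2 r x z = cK n * f x * r ^ (n + 5) := by
  obtain ⟨L, hL⟩ := oddK_const hf hf0 hf2 hlap x
  have hxn : 0 < x (Fin.last n) := hx
  have hc := cK_pos n
  suffices h : L = cK n * f x by rw [hL r hr, h]
  have key : ∀ δ > 0, |L - cK n * f x| ≤ δ * cK n := by
    intro δ hδ
    obtain ⟨η, hη, hcl⟩ := Metric.continuous_iff.1 hf x δ hδ
    set ρ := min η (x (Fin.last n)) with hρ
    have hρ0 : 0 < ρ := lt_min hη hxn
    have e1 : ∫ z, f z * oddK 2 ρ x z = ∫ z, f z * phiK 2 ρ x z := by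
      congr 1
      ext z
      by_cases hz : z (Fin.last n) ≤ 0
      · simp [hf0 z hz]
      · have hz' := not_le.1 hz
        have : phiK 2 ρ (reflK x) z = 0 := by
          refine phiK_zero two_ne_zero ?_
          rw [abs_of_pos hρ0]
          have h1 := PiLp.norm_apply_le (z - reflK x) (Fin.last n)
          have h2 : (z - reflK x) (Fin.last n) = z (Fin.last n) + x (Fin.last n) := by
            simp [reflK]; ring
          rw [h2, Real.norm_eq_abs, abs_of_pos (by linarith)] at h1
          have := min_le_right η (x (Fin.last n))
          linarith
        simp [oddK, this]
    have e2 : (L - cK n * f x) * ρ ^ (n + 5) = ∫ z, (f z - f x) * phiK 2 ρ x z := by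
      simp_rw [sub_mul]
      rw [integral_sub (integrable_mul_right hf (phiK_continuous 2 ρ x)
        (phiK_hcs two_ne_zero ρ x)) (integrable_mul_right continuous_const (phiK_continuous 2 ρ x)
        (phiK_hcs two_ne_zero ρ x)), integral_const_mul, phiK_scale hρ0, ← e1, hL ρ hρ0]
      ring
    have e3 : |∫ z, (f z - f x) * phiK 2 ρ x z| ≤ ∫ z, δ * phiK 2 ρ x z := by
      rw [← Real.norm_eq_abs]
      refine norm_integral_le_of_norm_le (integrable_mul_right continuous_const
        (phiK_continuous 2 ρ x) (phiK_hcs two_ne_zero ρ x)) (Eventually.of_forall fun z => ?_)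
      rw [Real.norm_eq_abs, abs_mul, abs_of_nonneg (phiK_nonneg 2 ρ x z)]
      by_cases hz : ‖z - x‖ < ρ
      · have := hcl z (by rw [dist_eq_norm]; exact hz.trans_le (min_le_left _ _))
        rw [Real.dist_eq] at this
        exact mul_le_mul_of_nonneg_right this.le (phiK_nonneg 2 ρ x z)
      · rw [phiK_zero two_ne_zero (by rw [abs_of_pos hρ0]; exact not_lt.1 hz)]
        simp
    rw [integral_const_mul, phiK_scale hρ0, ← e2, abs_mul, abs_of_pos (pow_pos hρ0 _),
      ← mul_assoc] at e3
    exact le_of_mul_le_mul_right e3 (pow_pos hρ0 _)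
  have : |L - cK n * f x| ≤ 0 := by
    refine le_of_forall_pos_le_add fun γ hγ => ?_
    have := key (γ / cK n) (by positivity)
    rw [div_mul_cancel₀ _ hc.ne'] at this
    linarith
  have := abs_nonpos_iff.1 this
  linarith


lemma scalar_ineq {s t σ D : ℝ} (hst : t ≤ s) (h1 : |s - σ| ≤ D) (h2 : |t - σ| ≤ D) :
    |(max s 0) ^ 2 - (max t 0) ^ 2 - 2 * max σ 0 * (s - t)| ≤ 2 * D * (s - t) := by
  rw [abs_le] at h1 h2
  have hD : 0 ≤ D := by linarith [h1.1, h1.2]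
  have hd : 0 ≤ s - t := by linarith
  rw [abs_le]
  rcases le_total t 0 with ht | ht
  · rw [max_eq_right ht]
    have hσ : max σ 0 ≤ D := max_le (by linarith [h2.1]) hD
    have hσ0 : 0 ≤ max σ 0 := le_max_right _ _
    rcases le_total s 0 with hs | hs
    · rw [max_eq_right hs]
      constructor <;> nlinarith
    · rw [max_eq_left hs]
      have : s ≤ 2 * D := by linarith [h1.2, h2.1]
      constructor <;> nlinarith
  · rw [max_eq_left ht, max_eq_left (ht.trans hst)]
    rcases le_total σ 0 with hσ | hσ
    · rw [max_eq_right hσ]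
      constructor <;> nlinarith
    · rw [max_eq_left hσ]
      constructor <;> nlinarith

lemma oddK_nonneg {n : ℕ} {r : ℝ} {x z : EuclideanSpace ℝ (Fin (n + 1))}
    (hx : 0 ≤ x (Fin.last n)) (hz : 0 ≤ z (Fin.last n)) : 0 ≤ oddK 2 r x z := by
  unfold oddK phiK
  have h := norm_sub_reflK x z
  have h2 : 0 ≤ x (Fin.last n) * z (Fin.last n) := mul_nonneg hx hz
  rw [sub_nonneg]
  exact pow_le_pow_left₀ (le_max_right _ _) (max_le_max_right 0 (by linarith)) 2

set_option maxHeartbeats 1000000 in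
lemma pointwise_ineq {n : ℕ} {R : ℝ} {x z : EuclideanSpace ℝ (Fin (n + 1))}
    (hx : 0 ≤ x (Fin.last n)) (hz : 0 ≤ z (Fin.last n)) (hR : 0 < R) (hxR : ‖x‖ ≤ R) :
    |oddK 2 R x z - 8 * x (Fin.last n) * z (Fin.last n) * phiK 1 R 0 z|
      ≤ ‖x‖ / R * oddK 2 (4 * R) x z := by
  have hab : 0 ≤ x (Fin.last n) * z (Fin.last n) := mul_nonneg hx hz
  have hX := norm_nonneg x
  have hZ := norm_nonneg z
  have hrn := norm_reflK x
  by_cases hcase : ‖z‖ ≤ 2 * R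
  · have q1 := abs_le.1 (abs_real_inner_le_norm z x)
    have q2 := abs_le.1 (abs_real_inner_le_norm z (reflK x))
    have n1 := norm_sub_sq_real z x
    have n2 := norm_sub_sq_real z (reflK x)
    have n3 := norm_sub_reflK x z
    rw [hrn] at q2 n2
    have hZX : ‖z‖ * ‖x‖ ≤ 2 * R * ‖x‖ := by gcongr
    have hXX : ‖x‖ ^ 2 ≤ R * ‖x‖ := by nlinarith
    have hXX0 : 0 ≤ ‖x‖ ^ 2 := by positivity
    have hRX : 0 ≤ R * ‖x‖ := by positivity
    have hs := scalar_ineq (s := R ^ 2 - ‖z - x‖ ^ 2) (t := R ^ 2 - ‖z - reflK x‖ ^ 2)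
      (σ := R ^ 2 - ‖z‖ ^ 2) (D := 5 * R * ‖x‖) (by linarith)
      (by rw [abs_le]; constructor <;> linarith [q1.1, q1.2])
      (by rw [abs_le]; constructor <;> linarith [q2.1, q2.2])
    have hdiff : (R ^ 2 - ‖z - x‖ ^ 2) - (R ^ 2 - ‖z - reflK x‖ ^ 2)
      = 4 * (x (Fin.last n) * z (Fin.last n)) := by rw [n3]; ring
    rw [hdiff] at hs
    have hZ2 : ‖z‖ ^ 2 ≤ 4 * R ^ 2 := by nlinarith
    have hRXR : R * ‖x‖ ≤ R ^ 2 := by nlinarith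
    have ht : 7 * R ^ 2 ≤ (4 * R) ^ 2 - ‖z - reflK x‖ ^ 2 := by linarith [q2.1, q2.2]
    have hs' : 7 * R ^ 2 ≤ (4 * R) ^ 2 - ‖z - x‖ ^ 2 := by linarith
    have hR2 : 0 ≤ R ^ 2 := by positivity
    have hbig : 56 * (x (Fin.last n) * z (Fin.last n)) * R ^ 2 ≤ oddK 2 (4 * R) x z := by
      unfold oddK phiK
      rw [max_eq_left (by linarith), max_eq_left (by linarith)]
      have : ((4 * R) ^ 2 - ‖z - x‖ ^ 2) ^ 2 - ((4 * R) ^ 2 - ‖z - reflK x‖ ^ 2) ^ 2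
        = 4 * (x (Fin.last n) * z (Fin.last n)) *
          (((4 * R) ^ 2 - ‖z - x‖ ^ 2) + ((4 * R) ^ 2 - ‖z - reflK x‖ ^ 2)) := by
        rw [n3]; ring
      rw [this]
      calc 56 * (x (Fin.last n) * z (Fin.last n)) * R ^ 2
          = 4 * (x (Fin.last n) * z (Fin.last n)) * (7 * R ^ 2 + 7 * R ^ 2) := by ring
        _ ≤ _ := mul_le_mul_of_nonneg_left (add_le_add hs' ht) (by linarith)
    have hlhs : oddK 2 R x z - 8 * x (Fin.last n) * z (Fin.last n) * phiK 1 R 0 z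
        = max (R ^ 2 - ‖z - x‖ ^ 2) 0 ^ 2 - max (R ^ 2 - ‖z - reflK x‖ ^ 2) 0 ^ 2
          - 2 * max (R ^ 2 - ‖z‖ ^ 2) 0 * (4 * (x (Fin.last n) * z (Fin.last n))) := by
      unfold oddK phiK
      rw [sub_zero]; ring
    rw [hlhs]
    refine hs.trans ?_
    calc _ = ‖x‖ / R * (40 * (x (Fin.last n) * z (Fin.last n)) * R ^ 2) := by
          field_simp; ring
      _ ≤ ‖x‖ / R * oddK 2 (4 * R) x z := by
          refine mul_le_mul_of_nonneg_left ?_ (by positivity)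
          linarith [mul_nonneg hab hR2]
  · have hcase' := not_le.1 hcase
    have a1 : |R| ≤ ‖z - x‖ := by
      rw [abs_of_pos hR]; linarith [norm_sub_norm_le z x]
    have a2 : |R| ≤ ‖z - reflK x‖ := by
      rw [abs_of_pos hR]; linarith [norm_sub_norm_le z (reflK x)]
    have a3 : |R| ≤ ‖z - 0‖ := by
      rw [abs_of_pos hR, sub_zero]; linarith
    unfold oddK at *
    rw [phiK_zero two_ne_zero a1, phiK_zero two_ne_zero a2, phiK_zero one_ne_zero a3]
    simp only [sub_zero, mul_zero, abs_zero]
    exact mul_nonneg (by positivity) (oddK_nonneg hx hz)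

/-- The limiting functional. -/
noncomputable def limA {n : ℕ} (f : EuclideanSpace ℝ (Fin (n + 1)) → ℝ) (R : ℝ) : ℝ :=
  ∫ z, f z * (8 * z (Fin.last n) * phiK 1 R 0 z)

lemma asym {n : ℕ} {f : EuclideanSpace ℝ (Fin (n + 1)) → ℝ} (hf : Continuous f)
    (hf0 : ∀ z, z (Fin.last n) ≤ 0 → f z = 0) (hf1 : ∀ z, -1 ≤ f z)
    (hf2 : ContDiffOn ℝ 2 f (halfSpace n)) (hlap : ∀ z ∈ halfSpace n, lapD f z = 0)
    {x : EuclideanSpace ℝ (Fin (n + 1))} (hx : x ∈ halfSpace n) {R : ℝ} (hR : 0 < R)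
    (hxR : ‖x‖ ≤ R) :
    |cK n * f x * R ^ (n + 5) - x (Fin.last n) * limA f R|
      ≤ ‖x‖ / R * (cK n * (f x + 2) * (4 * R) ^ (n + 5)) := by
  have hxn : 0 ≤ x (Fin.last n) := le_of_lt hx
  have hcont : Continuous fun z : EuclideanSpace ℝ (Fin (n + 1)) => 8 * z (Fin.last n) := by
    fun_prop
  have i1 := integrable_mul_right hf (oddK_continuous 2 R x) (oddK_hcs two_ne_zero R x)
  have i2 : Integrable fun z => f z * (8 * z (Fin.last n) * phiK 1 R 0 z) :=
    integrable_mul_right hf (hcont.mul (phiK_continuous 1 R 0))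
      (phiK_hcs one_ne_zero R 0).mul_left
  have i3 := integrable_mul_right hf (oddK_continuous 2 (4 * R) x)
    (oddK_hcs two_ne_zero (4 * R) x)
  have i4 : Integrable fun z => 2 * phiK 2 (4 * R) x z :=
    integrable_mul_right continuous_const (phiK_continuous 2 (4 * R) x)
      (phiK_hcs two_ne_zero (4 * R) x)
  have hR4 : 0 < 4 * R := by linarith
  have e1 : cK n * f x * R ^ (n + 5) - x (Fin.last n) * limA f R
      = ∫ z, (f z * oddK 2 R x z - x (Fin.last n) * (f z * (8 * z (Fin.last n) * phiK 1 R 0 z))) := by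
    rw [integral_sub i1 (i2.const_mul _), integral_const_mul, mean_value hf hf0 hf2 hlap hx hR]
    rfl
  have e2 : ‖x‖ / R * (cK n * (f x + 2) * (4 * R) ^ (n + 5))
      = ∫ z, ‖x‖ / R * (f z * oddK 2 (4 * R) x z + 2 * phiK 2 (4 * R) x z) := by
    rw [integral_const_mul, integral_add i3 i4, mean_value hf hf0 hf2 hlap hx hR4,
      integral_const_mul, phiK_scale hR4]
    ring
  rw [e1, e2, ← Real.norm_eq_abs]
  refine norm_integral_le_of_norm_le ((i3.add i4).const_mul _) (Eventually.of_forall fun z => ?_)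
  have hφ := phiK_nonneg 2 (4 * R) x z
  have hq : 0 ≤ ‖x‖ / R := by positivity
  by_cases hz : z (Fin.last n) ≤ 0
  · simp only [hf0 z hz, zero_mul, mul_zero, sub_zero, norm_zero, zero_add]
    positivity
  · have hz' : 0 ≤ z (Fin.last n) := (not_le.1 hz).le
    have hp := pointwise_ineq hxn hz' hR hxR
    have hk := oddK_nonneg (r := 4 * R) hxn hz'
    have hk2 : oddK 2 (4 * R) x z ≤ phiK 2 (4 * R) x z := by
      have := phiK_nonneg 2 (4 * R) (reflK x) z
      unfold oddK; linarith
    have hfa : |f z| ≤ f z + 2 := abs_le.2 ⟨by linarith [hf1 z], by linarith⟩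
    have : f z * oddK 2 R x z - x (Fin.last n) * (f z * (8 * z (Fin.last n) * phiK 1 R 0 z))
      = f z * (oddK 2 R x z - 8 * x (Fin.last n) * z (Fin.last n) * phiK 1 R 0 z) := by ring
    rw [this, Real.norm_eq_abs, abs_mul]
    calc _ ≤ (f z + 2) * (‖x‖ / R * oddK 2 (4 * R) x z) := by
          have := abs_nonneg (f z)
          exact mul_le_mul hfa hp (abs_nonneg _) (by linarith)
      _ = ‖x‖ / R * (f z * oddK 2 (4 * R) x z + 2 * oddK 2 (4 * R) x z) := by ring
      _ ≤ _ := by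
          refine mul_le_mul_of_nonneg_left ?_ hq
          linarith

lemma ratio_const {n : ℕ} {f : EuclideanSpace ℝ (Fin (n + 1)) → ℝ} (hf : Continuous f)
    (hf0 : ∀ z, z (Fin.last n) ≤ 0 → f z = 0) (hf1 : ∀ z, -1 ≤ f z)
    (hf2 : ContDiffOn ℝ 2 f (halfSpace n)) (hlap : ∀ z ∈ halfSpace n, lapD f z = 0)
    {x y : EuclideanSpace ℝ (Fin (n + 1))} (hx : x ∈ halfSpace n) (hy : y ∈ halfSpace n) :
    f x * y (Fin.last n) = f y * x (Fin.last n) := by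
  have hlim : ∀ x ∈ halfSpace n, Tendsto (fun R : ℝ => limA f R / R ^ (n + 5)) atTop
      (𝓝 (cK n * f x / x (Fin.last n))) := by
    intro x hx
    have hxn : 0 < x (Fin.last n) := hx
    set Q : ℝ := ‖x‖ * (cK n * (f x + 2) * 4 ^ (n + 5)) / x (Fin.last n) with hQ
    have h0 : Tendsto (fun R : ℝ => Q / R) atTop (𝓝 0) := tendsto_const_nhds.div_atTop tendsto_id
    rw [tendsto_iff_norm_sub_tendsto_zero]
    refine squeeze_zero' (Eventually.of_forall fun R => norm_nonneg _) ?_ h0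
    filter_upwards [eventually_ge_atTop ‖x‖, eventually_gt_atTop 0] with R hxR hR
    have ha := asym hf hf0 hf1 hf2 hlap hx hR hxR
    have hRp : 0 < R ^ (n + 5) := by positivity
    have : limA f R / R ^ (n + 5) - cK n * f x / x (Fin.last n)
        = -((cK n * f x * R ^ (n + 5) - x (Fin.last n) * limA f R)
          / (x (Fin.last n) * R ^ (n + 5))) := by
      field_simp
      ring
    rw [this, norm_neg, Real.norm_eq_abs, abs_div,
      abs_of_pos (show 0 < x (Fin.last n) * R ^ (n + 5) by positivity),
      div_le_iff₀ (by positivity)]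
    refine ha.trans (le_of_eq ?_)
    rw [hQ, mul_pow]
    field_simp
  have h := tendsto_nhds_unique (hlim x hx) (hlim y hy)
  have hxn : 0 < x (Fin.last n) := hx
  have hyn : 0 < y (Fin.last n) := hy
  have hc := cK_pos n
  rw [div_eq_div_iff hxn.ne' hyn.ne', mul_assoc, mul_assoc] at h
  exact mul_left_cancel₀ hc.ne' h

lemma closure_halfSpaceK (n : ℕ) : closure (halfSpace n) = {z | 0 ≤ z (Fin.last n)} := by
  have hcont : Continuous fun z : EuclideanSpace ℝ (Fin (n + 1)) => z (Fin.last n) := by fun_prop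
  apply Subset.antisymm
  · exact closure_minimal (fun z (hz : 0 < z (Fin.last n)) => show 0 ≤ z (Fin.last n) from le_of_lt hz) (isClosed_le continuous_const hcont)
  · intro z hz
    have hz' : 0 ≤ z (Fin.last n) := hz
    have h1 : Tendsto (fun k : ℕ => z + (1 / ((k : ℝ) + 1)) •
        (EuclideanSpace.single (Fin.last n) (1 : ℝ))) atTop (𝓝 z) := by
      have := (tendsto_one_div_add_atTop_nhds_zero_nat (𝕜 := ℝ)).smul_const
        (EuclideanSpace.single (Fin.last n) (1 : ℝ))
      simpa using this.const_add z
    refine mem_closure_of_tendsto h1 (Eventually.of_forall fun k => ?_)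
    change 0 < (z + (1 / ((k : ℝ) + 1)) •
        (EuclideanSpace.single (Fin.last n) (1 : ℝ))) (Fin.last n)
    have : 0 < 1 / ((k : ℝ) + 1) := by positivity
    simp only [PiLp.add_apply, PiLp.smul_apply, EuclideanSpace.single_apply, if_true, smul_eq_mul,
      mul_one]
    linarith

lemma lapD_eq {m : ℕ} {u : EuclideanSpace ℝ (Fin m) → ℝ} {z : EuclideanSpace ℝ (Fin m)}
    (h : ContDiffAt ℝ 2 u z) : lapD u z = laplacian u z := by
  unfold lapD laplacian
  refine Finset.sum_congr rfl fun i _ => ?_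
  rw [iteratedFDeriv_two_apply]
  have h1 : DifferentiableAt ℝ (fderiv ℝ u) z :=
    (h.fderiv_right (m := 1) (by norm_num)).differentiableAt (by norm_num)
  unfold dirD
  rw [fderiv_clm_apply h1 (differentiableAt_const _)]
  simp

lemma norm_gradient_sq {m : ℕ} (u : EuclideanSpace ℝ (Fin m) → ℝ) (z : EuclideanSpace ℝ (Fin m)) :
    ‖gradient u z‖ ^ 2 = ∑ i, (dirD (EuclideanSpace.single i 1) u z) ^ 2 := by
  rw [EuclideanSpace.real_norm_sq_eq]
  refine Finset.sum_congr rfl fun i _ => ?_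
  have : inner ℝ (gradient u z) (EuclideanSpace.single i (1 : ℝ))
      = fderiv ℝ u z (EuclideanSpace.single i 1) := by
    unfold gradient
    exact InnerProductSpace.toDual_symm_apply
  unfold dirD
  rw [← this, EuclideanSpace.inner_single_right]
  simp

lemma lapD_exp {n : ℕ} {u : EuclideanSpace ℝ (Fin (n + 1)) → ℝ}
    (hu2 : ContDiffOn ℝ 2 u (halfSpace n)) {z : EuclideanSpace ℝ (Fin (n + 1))}
    (hz : z ∈ halfSpace n) :
    lapD (fun y => Real.exp (u y) - 1) z
      = Real.exp (u z) * (‖gradient u z‖ ^ 2 + laplacian u z) := by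
  have hcont : Continuous fun z : EuclideanSpace ℝ (Fin (n + 1)) => z (Fin.last n) := by fun_prop
  have ho : IsOpen (halfSpace n) := isOpen_lt continuous_const hcont
  have hat : ∀ y ∈ halfSpace n, ContDiffAt ℝ 2 u y := fun y hy => hu2.contDiffAt (ho.mem_nhds hy)
  have hd : ∀ y ∈ halfSpace n, DifferentiableAt ℝ u y :=
    fun y hy => (hat y hy).differentiableAt (by norm_num)
  rw [← lapD_eq (hat z hz), norm_gradient_sq]
  unfold lapD
  rw [← Finset.sum_add_distrib, Finset.mul_sum]
  refine Finset.sum_congr rfl fun i _ => ?_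
  set v : EuclideanSpace ℝ (Fin (n + 1)) := EuclideanSpace.single i 1
  have hexp : ∀ y ∈ halfSpace n, dirD v (fun y => Real.exp (u y)) y = Real.exp (u y) * dirD v u y := by
    intro y hy
    unfold dirD
    rw [fderiv_exp (hd y hy)]
    simp
  have h1 : dirD v (fun y => Real.exp (u y) - 1) =ᶠ[𝓝 z] fun y => Real.exp (u y) * dirD v u y := by
    filter_upwards [ho.mem_nhds hz] with y hy
    rw [← hexp y hy]
    unfold dirD
    rw [fderiv_sub_const]
  have h2 : DifferentiableAt ℝ (dirD v u) z := by
    have h3 : DifferentiableAt ℝ (fderiv ℝ u) z :=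
      ((hat z hz).fderiv_right (m := 1) (by norm_num)).differentiableAt (by norm_num)
    exact h3.clm_apply (differentiableAt_const _)
  have h4 : dirD v (dirD v (fun y => Real.exp (u y) - 1)) z
      = dirD v (fun y => Real.exp (u y) * dirD v u y) z := by
    change fderiv ℝ _ z v = fderiv ℝ _ z v
    rw [h1.fderiv_eq]
  rw [h4, dirD_mul (hd z hz).exp h2, hexp z hz]
  ring

lemma main_classification (n : ℕ)
    (u : EuclideanSpace ℝ (Fin (n + 1)) → ℝ)
    (hu2 : ContDiffOn ℝ 2 u (halfSpace n))
    (huc : ContinuousOn u (closure (halfSpace n)))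
    (heq : ∀ x ∈ halfSpace n, -laplacian u x = ‖gradient u x‖ ^ 2)
    (hbc : ∀ x : EuclideanSpace ℝ (Fin (n + 1)), x (Fin.last n) = 0 → u x = 0) :
    ∃ lam : ℝ, 0 ≤ lam ∧ ∀ x ∈ closure (halfSpace n),
      Real.exp (u x) = 1 + lam * x (Fin.last n) := by
  set e : EuclideanSpace ℝ (Fin (n + 1)) := EuclideanSpace.single (Fin.last n) 1 with he
  have hen : e (Fin.last n) = 1 := by simp [he]
  have hcont : Continuous fun z : EuclideanSpace ℝ (Fin (n + 1)) => z (Fin.last n) := by fun_prop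
  have ho : IsOpen (halfSpace n) := isOpen_lt continuous_const hcont
  rw [closure_halfSpaceK] at huc ⊢
  set clip : EuclideanSpace ℝ (Fin (n + 1)) → EuclideanSpace ℝ (Fin (n + 1)) :=
    fun z => z + (max (z (Fin.last n)) 0 - z (Fin.last n)) • e with hclip
  have hclipn : ∀ z, clip z (Fin.last n) = max (z (Fin.last n)) 0 := by
    intro z; simp [hclip, hen]
  have hclipc : Continuous clip :=
    continuous_id.add (((hcont.max continuous_const).sub hcont).smul continuous_const)
  set f : EuclideanSpace ℝ (Fin (n + 1)) → ℝ := fun z => Real.exp (u (clip z)) - 1 with hfdef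
  have hfeq : ∀ z, 0 ≤ z (Fin.last n) → f z = Real.exp (u z) - 1 := by
    intro z hz
    have : clip z = z := by simp [hclip, max_eq_left hz]
    simp [hfdef, this]
  have hf : Continuous f := by
    have : Continuous fun z => u (clip z) :=
      huc.comp_continuous hclipc (fun z => by simp [hclipn z])
    exact (Real.continuous_exp.comp this).sub continuous_const
  have hf0 : ∀ z, z (Fin.last n) ≤ 0 → f z = 0 := by
    intro z hz
    have : u (clip z) = 0 := hbc _ (by rw [hclipn, max_eq_right hz])
    simp [hfdef, this]
  have hf1 : ∀ z, -1 ≤ f z := fun z => by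
    have := Real.exp_pos (u (clip z))
    simp only [hfdef]; linarith
  have hf2 : ContDiffOn ℝ 2 f (halfSpace n) :=
    (hu2.exp.sub contDiffOn_const).congr fun z hz => hfeq z (le_of_lt hz)
  have hlap : ∀ z ∈ halfSpace n, lapD f z = 0 := by
    intro z hz
    have : f =ᶠ[𝓝 z] fun y => Real.exp (u y) - 1 := by
      filter_upwards [ho.mem_nhds hz] with y hy using hfeq y (le_of_lt hy)
    rw [lapD_congr this, lapD_exp hu2 hz, ← heq z hz]
    simp
  have heH : e ∈ halfSpace n := by
    change 0 < e (Fin.last n)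
    rw [hen]; exact one_pos
  have hlin : ∀ x ∈ halfSpace n, f x = f e * x (Fin.last n) := by
    intro x hx
    have := ratio_const hf hf0 hf1 hf2 hlap hx heH
    rwa [hen, mul_one] at this
  refine ⟨f e, ?_, ?_⟩
  · by_contra hneg
    have hneg' := not_le.1 hneg
    have ht : 0 < 2 / (-f e) := div_pos two_pos (by linarith)
    have hmem : (2 / (-f e)) • e ∈ halfSpace n := by
      change 0 < ((2 / (-f e)) • e) (Fin.last n)
      simpa [hen] using hneg'
    have h1 := hlin _ hmem
    have h2 := hf1 ((2 / (-f e)) • e)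
    have h3 : ((2 / (-f e)) • e) (Fin.last n) = 2 / (-f e) := by
      rw [PiLp.smul_apply, hen, smul_eq_mul, mul_one]
    rw [h1, h3] at h2
    have : f e * (2 / (-f e)) = -2 := by
      have : f e ≠ 0 := hneg'.ne
      field_simp
    linarith
  · intro x hx
    have hx' : 0 ≤ x (Fin.last n) := hx
    rcases hx'.eq_or_lt with h | h
    · rw [hbc x h.symm, ← h]; simp
    · have h1 := hlin x h
      rw [hfeq x hx'] at h1
      linarith


end Aux

/-- For `p = 2`, any classical solution of `-Δu = |∇u|²` in the half-space with zero
boundary data satisfies `e^u = 1 + λ xₙ` for some constant `λ ≥ 0`. -/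
theorem classification_p_two (n : ℕ)
    (u : EuclideanSpace ℝ (Fin (n + 1)) → ℝ)
    (hu2 : ContDiffOn ℝ 2 u (halfSpace n))
    (huc : ContinuousOn u (closure (halfSpace n)))
    (heq : ∀ x ∈ halfSpace n, -laplacian u x = ‖gradient u x‖ ^ 2)
    (hbc : ∀ x : EuclideanSpace ℝ (Fin (n + 1)), x (Fin.last n) = 0 → u x = 0) :
    ∃ lam : ℝ, 0 ≤ lam ∧ ∀ x ∈ closure (halfSpace n),
      Real.exp (u x) = 1 + lam * x (Fin.last n) := by
  exact main_classification n u hu2 huc heq hbc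
end

section
/- Let n ≥ 1 and p > 1, and set β = 1/(p-1). There exists a constant K > 0, depending only on p and n, such that for every classical solution u ∈ C²(ℝⁿ₊) ∩ C(cl ℝⁿ₊) of -Δu = |∇u|^p in ℝⁿ₊ with u = 0 on ∂ℝⁿ₊, one has |∇u(x)| ≤ K xₙ^{-β} for every x ∈ ℝⁿ₊. -/
section
open Filter Topology

lemma bern_dq {E : Type*} [NormedAddCommGroup E] [NormedSpace ℝ E] {v : E → ℝ} {L : E →L[ℝ] ℝ}
    {x : E} (hv : HasStrictFDerivAt v L x) {y : ℕ → E} {h : ℕ → ℝ} (hy : Tendsto y atTop (𝓝 x))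
    (hh : Tendsto h atTop (𝓝 0)) (h0 : ∀ m, 0 < h m) (e : E) :
    Tendsto (fun m => (v (y m + h m • e) - v (y m)) / h m) atTop (𝓝 (L e)) := by
  have h1 : Tendsto (fun m => (y m + h m • e, y m)) atTop (𝓝 (x, x)) := by
    have : Tendsto (fun m => y m + h m • e) atTop (𝓝 (x + (0:ℝ) • e)) :=
      hy.add (hh.smul_const e)
    rw [zero_smul, add_zero] at this
    exact this.prodMk_nhds hy
  have h2 := hv.isLittleO.comp_tendsto h1
  have h3 : (fun m => v (y m + h m • e) - v (y m) - L (h m • e)) =o[atTop] h := by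
    have h4 : (fun m => h m • e) =O[atTop] h :=
      Asymptotics.IsBigO.of_bound ‖e‖ (Eventually.of_forall fun m => by
        rw [norm_smul, mul_comm])
    refine Asymptotics.IsLittleO.trans_isBigO ?_ h4
    refine h2.congr (fun m => ?_) (fun m => ?_) <;> simp
  have h5 := h3.tendsto_div_nhds_zero
  have h6 := h5.add_const (L e)
  rw [zero_add] at h6
  refine h6.congr fun m => ?_
  have := (h0 m).ne'
  simp only [map_smul, smul_eq_mul]
  field_simp
  ring

lemma bern_second {q q' : ℝ → ℝ} {q2 : ℝ} (h1 : ∀ᶠ t in 𝓝 0, HasDerivAt q (q' t) t)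
    (h2 : HasDerivAt q' q2 0) (hm : IsLocalMax q 0) : q' 0 = 0 ∧ q2 ≤ 0 := by
  have hz : q' 0 = 0 := hm.hasDerivAt_eq_zero h1.self_of_nhds
  refine ⟨hz, ?_⟩
  by_contra hq
  push Not at hq
  have e1 : deriv q =ᶠ[𝓝 0] q' := h1.mono fun t ht => ht.deriv
  have e2 : deriv (deriv q) 0 = q2 := by rw [e1.deriv_eq, h2.deriv]
  have hmin : IsLocalMin q 0 := isLocalMin_of_deriv_deriv_pos (by rw [e2]; exact hq)
    (by rw [e1.self_of_nhds, hz]) h1.self_of_nhds.continuousAt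
  have hc : q =ᶠ[𝓝 0] fun _ => q 0 := by
    filter_upwards [hm, hmin] with t a b using le_antisymm a b
  have e3 : deriv q =ᶠ[𝓝 0] fun _ => 0 := by
    have := hc.deriv
    simpa using this
  have : deriv (deriv q) 0 = 0 := by rw [e3.deriv_eq]; simp
  linarith

lemma bern_log {w w' f f' : ℝ → ℝ} {w2 f2 k : ℝ}
    (hw : ∀ᶠ t in 𝓝 0, HasDerivAt w (w' t) t) (hw2 : HasDerivAt w' w2 0)
    (hf : ∀ᶠ t in 𝓝 0, HasDerivAt f (f' t) t) (hf2 : HasDerivAt f' f2 0)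
    (w0 : 0 < w 0) (f0 : 0 < f 0) (hm : IsLocalMax (fun t => f t ^ k * w t) 0) :
    w' 0 / w 0 + k * (f' 0 / f 0) = 0 ∧
    w2 / w 0 - (w' 0 / w 0) ^ 2 + k * (f2 / f 0 - (f' 0 / f 0) ^ 2) ≤ 0 := by
  have pw : ∀ᶠ t in 𝓝 0, 0 < w t := hw.self_of_nhds.continuousAt.eventually (lt_mem_nhds w0)
  have pf : ∀ᶠ t in 𝓝 0, 0 < f t := hf.self_of_nhds.continuousAt.eventually (lt_mem_nhds f0)
  have hm' : IsLocalMax (fun t => Real.log (w t) + k * Real.log (f t)) 0 := by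
    filter_upwards [hm, pw, pf] with t a b c
    have := Real.log_le_log (by positivity) a
    rw [Real.log_mul (by positivity) (by positivity), Real.log_mul (by positivity) (by positivity),
      Real.log_rpow c, Real.log_rpow f0] at this
    linarith
  have hd : ∀ᶠ t in 𝓝 0, HasDerivAt (fun t => Real.log (w t) + k * Real.log (f t))
      (w' t / w t + k * (f' t / f t)) t := by
    filter_upwards [hw, hf, pw, pf] with t a b c d
    exact (a.log c.ne').add ((b.log d.ne').const_mul k)
  have hd2 := (hw2.div hw.self_of_nhds w0.ne').add
    ((hf2.div hf.self_of_nhds f0.ne').const_mul k)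
  obtain ⟨a, b⟩ := bern_second hd hd2 hm'
  refine ⟨a, le_of_eq_of_le ?_ b⟩
  have := w0.ne'
  have := f0.ne'
  field_simp

lemma bern_final {N p k C1 R φ W D : ℝ} (hN : 0 < N) (hp : 1 < p) (hk : 0 < k) (hR : 0 < R)
    (hφ : 0 < φ) (hW : 0 < W) (hC : 0 ≤ C1)
    (hD : D ≤ k * W * (W ^ (1/2 : ℝ) * (2 / R) / φ))
    (h : 2 / N * W ^ p / W ≤ C1 / (R ^ 2 * φ ^ 2) + 2 * (p / 2 * W ^ (p / 2 - 1) * D) / W) :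
    W ^ ((p - 1) / 2) * φ ≤ (1 + N * p * k + N * C1 / 2) / R := by
  set s := W ^ ((p - 1) / 2) with hs
  have s0 : 0 < s := Real.rpow_pos_of_pos hW _
  have e1 : W ^ p / W = s ^ 2 := by
    rw [hs, ← Real.rpow_natCast, ← Real.rpow_mul hW.le, div_eq_iff hW.ne',
      ← Real.rpow_add_one hW.ne']
    congr 1; push_cast; ring
  have e2 : W ^ (p / 2 - 1) * W ^ (1 / 2 : ℝ) = s := by
    rw [← Real.rpow_add hW]; congr 1; ring
  have b1 : 2 * (p / 2 * W ^ (p / 2 - 1) * D) / W ≤ 2 * p * k * s / (R * φ) := by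
    have : W ^ (p / 2 - 1) * D ≤ W ^ (p / 2 - 1) * (k * W * (W ^ (1/2 : ℝ) * (2 / R) / φ)) := by
      gcongr
    rw [div_le_iff₀ hW]
    calc _ = p * (W ^ (p / 2 - 1) * D) := by ring
      _ ≤ p * (W ^ (p / 2 - 1) * (k * W * (W ^ (1/2 : ℝ) * (2 / R) / φ))) := by gcongr
      _ = 2 * p * k * (W ^ (p / 2 - 1) * W ^ (1 / 2 : ℝ)) / (R * φ) * W := by field_simp
      _ = _ := by rw [e2]
  have b2 : 2 / N * s ^ 2 ≤ C1 / (R ^ 2 * φ ^ 2) + 2 * p * k * s / (R * φ) := by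
    rw [← e1, ← mul_div_assoc]; linarith
  set y := s * φ * R with hy
  have y0 : 0 < y := by positivity
  have b3 : y ^ 2 ≤ N * C1 / 2 + N * p * k * y := by
    have := mul_le_mul_of_nonneg_right b2 (show 0 ≤ N / 2 * (R ^ 2 * φ ^ 2) by positivity)
    have l : 2 / N * s ^ 2 * (N / 2 * (R ^ 2 * φ ^ 2)) = y ^ 2 := by rw [hy]; field_simp
    have r : (C1 / (R ^ 2 * φ ^ 2) + 2 * p * k * s / (R * φ)) * (N / 2 * (R ^ 2 * φ ^ 2))
      = N * C1 / 2 + N * p * k * y := by rw [hy]; field_simp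
    rwa [l, r] at this
  rw [le_div_iff₀ hR]
  change y ≤ _
  have hA : 0 ≤ N * p * k := by positivity
  have hB : 0 ≤ N * C1 / 2 := by positivity
  by_contra hcon
  push Not at hcon
  nlinarith

noncomputable abbrev bE {N : ℕ} (i : Fin N) : EuclideanSpace ℝ (Fin N) := EuclideanSpace.single i 1

noncomputable def bG {N : ℕ} (u : EuclideanSpace ℝ (Fin N) → ℝ) (j : Fin N)
    (x : EuclideanSpace ℝ (Fin N)) : ℝ := fderiv ℝ u x (bE j)

noncomputable def bH {N : ℕ} (u : EuclideanSpace ℝ (Fin N) → ℝ) (i j : Fin N)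
    (x : EuclideanSpace ℝ (Fin N)) : ℝ := fderiv ℝ (bG u j) x (bE i)

noncomputable def bD {N : ℕ} (h : ℝ) (v : EuclideanSpace ℝ (Fin N) → ℝ) (i : Fin N)
    (x : EuclideanSpace ℝ (Fin N)) : ℝ := (v (x + h • bE i) - v x) / h

noncomputable def bPhi {N : ℕ} (x0 : EuclideanSpace ℝ (Fin N)) (R : ℝ)
    (x : EuclideanSpace ℝ (Fin N)) : ℝ := 1 - ‖x - x0‖ ^ 2 / R ^ 2

noncomputable def bW {N : ℕ} (h : ℝ) (u : EuclideanSpace ℝ (Fin N) → ℝ)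
    (x : EuclideanSpace ℝ (Fin N)) : ℝ := ∑ i, bD h u i x ^ 2

lemma bG_contDiffAt {N : ℕ} {u : EuclideanSpace ℝ (Fin N) → ℝ} {x : EuclideanSpace ℝ (Fin N)}
    (hu : ContDiffAt ℝ 2 u x) (j : Fin N) : ContDiffAt ℝ 1 (bG u j) x := by
  have h1 : ContDiffAt ℝ 1 (fderiv ℝ u) x := hu.fderiv_right (by norm_num)
  exact h1.clm_apply contDiffAt_const

lemma bH_eq {N : ℕ} {u : EuclideanSpace ℝ (Fin N) → ℝ} {x : EuclideanSpace ℝ (Fin N)}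
    (hu : ContDiffAt ℝ 2 u x) (i j : Fin N) :
    bH u i j x = fderiv ℝ (fderiv ℝ u) x (bE i) (bE j) := by
  have h1 : ContDiffAt ℝ 1 (fderiv ℝ u) x := hu.fderiv_right (by norm_num)
  have h2 := (h1.differentiableAt (by norm_num)).hasFDerivAt.clm_apply
    (hasFDerivAt_const (bE j) x)
  unfold bH
  have h3 : HasFDerivAt (bG u j) _ x := h2
  rw [h3.fderiv]
  simp

lemma bH_symm {N : ℕ} {u : EuclideanSpace ℝ (Fin N) → ℝ} {x : EuclideanSpace ℝ (Fin N)}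
    (hu : ContDiffAt ℝ 2 u x) (i j : Fin N) : bH u i j x = bH u j i x := by
  rw [bH_eq hu, bH_eq hu]
  exact (hu.isSymmSndFDerivAt (by simp)) _ _

lemma bern_comp {N : ℕ} {v : EuclideanSpace ℝ (Fin N) → ℝ} {x z : EuclideanSpace ℝ (Fin N)}
    (j : Fin N) {t : ℝ} (hv : DifferentiableAt ℝ v (x + t • bE j + z)) :
    HasDerivAt (fun t : ℝ => v (x + t • bE j + z)) (fderiv ℝ v (x + t • bE j + z) (bE j)) t := by
  have h1 : HasDerivAt (fun t : ℝ => x + t • bE j + z) ((1:ℝ) • bE j) t :=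
    (((hasDerivAt_id t).smul_const (bE j)).const_add x).add_const z
  rw [one_smul] at h1
  exact hv.hasFDerivAt.comp_hasDerivAt t h1

lemma bern_comp0 {N : ℕ} {v : EuclideanSpace ℝ (Fin N) → ℝ} {x : EuclideanSpace ℝ (Fin N)}
    (j : Fin N) {t : ℝ} (hv : DifferentiableAt ℝ v (x + t • bE j)) :
    HasDerivAt (fun t : ℝ => v (x + t • bE j)) (fderiv ℝ v (x + t • bE j) (bE j)) t := by
  have := bern_comp (z := 0) j (t := t) (v := v) (x := x) (by simpa using hv)
  simpa using this

lemma bD_deriv {N : ℕ} {v : EuclideanSpace ℝ (Fin N) → ℝ} {x : EuclideanSpace ℝ (Fin N)}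
    (h : ℝ) (i j : Fin N) {t : ℝ} (hv : DifferentiableAt ℝ v (x + t • bE j))
    (hv' : DifferentiableAt ℝ v (x + t • bE j + h • bE i)) :
    HasDerivAt (fun t : ℝ => bD h v i (x + t • bE j))
      (bD h (fun y => fderiv ℝ v y (bE j)) i (x + t • bE j)) t := by
  unfold bD
  exact ((bern_comp j hv').sub (bern_comp0 j hv)).div_const h

lemma bPhi_line {N : ℕ} (x0 x : EuclideanSpace ℝ (Fin N)) (R : ℝ) (j : Fin N) (t : ℝ) :
    bPhi x0 R (x + t • bE j) = bPhi x0 R x - (2 * t * (x j - x0 j) + t ^ 2) / R ^ 2 := by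
  unfold bPhi
  have : x + t • bE j - x0 = (x - x0) + t • bE j := by abel
  rw [this, norm_add_sq_real, inner_smul_right, EuclideanSpace.inner_single_right, norm_smul]
  simp
  ring

lemma bern_line {N : ℕ} {U : Set (EuclideanSpace ℝ (Fin N))} (hU : IsOpen U)
    {u : EuclideanSpace ℝ (Fin N) → ℝ} (hu : ContDiffOn ℝ 2 u U)
    {x x0 : EuclideanSpace ℝ (Fin N)} {h R k : ℝ} (hx : x ∈ U) (hxh : ∀ i, x + h • bE i ∈ U)
    (hW : 0 < bW h u x) (hφ : 0 < bPhi x0 R x)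
    (hm : IsLocalMax (fun y => bPhi x0 R y ^ k * bW h u y) x) (j : Fin N) :
    (2 * ∑ i, bD h u i x * bD h (bG u j) i x) / bW h u x
      + k * ((-2 * (x j - x0 j) / R ^ 2) / bPhi x0 R x) = 0 ∧
    (2 * ∑ i, (bD h (bG u j) i x ^ 2 + bD h u i x * bD h (bH u j j) i x)) / bW h u x
      - ((2 * ∑ i, bD h u i x * bD h (bG u j) i x) / bW h u x) ^ 2
      + k * ((-2 / R ^ 2) / bPhi x0 R x - ((-2 * (x j - x0 j) / R ^ 2) / bPhi x0 R x) ^ 2) ≤ 0 := by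
  have hcd : ∀ y ∈ U, ContDiffAt ℝ 2 u y := fun y hy => hu.contDiffAt (hU.mem_nhds hy)
  have hline : Tendsto (fun t : ℝ => x + t • bE j) (𝓝 0) (𝓝 x) := by
    have : Continuous (fun t : ℝ => x + t • bE j) := by fun_prop
    simpa using this.tendsto 0
  have hlineh : ∀ i, Tendsto (fun t : ℝ => x + t • bE j + h • bE i) (𝓝 0) (𝓝 (x + h • bE i)) :=
    fun i => hline.add_const _
  have ev : ∀ᶠ t : ℝ in 𝓝 0, x + t • bE j ∈ U ∧ ∀ i, x + t • bE j + h • bE i ∈ U := by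
    refine (hline.eventually (hU.mem_nhds hx)).and ?_
    exact eventually_all.2 fun i => (hlineh i).eventually (hU.mem_nhds (hxh i))
  have d1 : ∀ᶠ t : ℝ in 𝓝 0, HasDerivAt (fun t : ℝ => bW h u (x + t • bE j))
      (2 * ∑ i, bD h u i (x + t • bE j) * bD h (bG u j) i (x + t • bE j)) t := by
    filter_upwards [ev] with t ht
    unfold bW
    have := HasDerivAt.fun_sum (u := Finset.univ) fun i _ => (bD_deriv h i j
      ((hcd _ ht.1).differentiableAt (by norm_num))
      ((hcd _ (ht.2 i)).differentiableAt (by norm_num))).fun_pow 2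
    refine this.congr_deriv ?_
    rw [Finset.mul_sum]
    refine Finset.sum_congr rfl fun i _ => ?_
    have e : bD h (bG u j) i = bD h (fun y => fderiv ℝ u y (bE j)) i := rfl
    rw [e]
    norm_num
    ring
  have ev0 := ev.self_of_nhds
  have d2 : HasDerivAt (fun t : ℝ =>
      2 * ∑ i, bD h u i (x + t • bE j) * bD h (bG u j) i (x + t • bE j))
      (2 * ∑ i, (bD h (bG u j) i x ^ 2 + bD h u i x * bD h (bH u j j) i x)) 0 := by
    have := (HasDerivAt.fun_sum (u := Finset.univ) fun i _ => (bD_deriv h i j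
      ((hcd _ ev0.1).differentiableAt (by norm_num))
      ((hcd _ (ev0.2 i)).differentiableAt (by norm_num))).mul (bD_deriv h i j
      ((bG_contDiffAt (hcd _ ev0.1) j).differentiableAt (by norm_num))
      ((bG_contDiffAt (hcd _ (ev0.2 i)) j).differentiableAt (by norm_num)))).const_mul 2
    refine this.congr_deriv ?_
    congr 1
    refine Finset.sum_congr rfl fun i _ => ?_
    rw [zero_smul, add_zero, sq]
    rfl
  have f1 : ∀ t : ℝ, HasDerivAt (fun t : ℝ => bPhi x0 R (x + t • bE j))
      (-2 * (x j - x0 j) / R ^ 2 - 2 / R ^ 2 * t) t := by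
    intro t
    simp only [bPhi_line]
    have a := (((hasDerivAt_id t).const_mul 2).mul_const (x j - x0 j)).add ((hasDerivAt_id t).pow 2)
    have b := (a.div_const (R ^ 2)).const_sub (bPhi x0 R x)
    refine b.congr_deriv ?_
    simp
    ring
  have f2 : HasDerivAt (fun t : ℝ => (-2 * (x j - x0 j) / R ^ 2 - 2 / R ^ 2 * t))
      (-2 / R ^ 2) 0 := by
    have := (((hasDerivAt_id (0:ℝ)).const_mul (2 / R ^ 2)).const_sub (-2 * (x j - x0 j) / R ^ 2))
    refine this.congr_deriv ?_
    ring
  have hm' : IsLocalMax (fun t : ℝ => bPhi x0 R (x + t • bE j) ^ k * bW h u (x + t • bE j)) 0 := by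
    have := hline.eventually hm
    filter_upwards [this] with t ht
    simpa using ht
  have := bern_log d1 d2 (Eventually.of_forall f1) f2 (by simpa using hW) (by simpa using hφ) hm'
  simpa using this

noncomputable def bW0 {N : ℕ} (u : EuclideanSpace ℝ (Fin N) → ℝ)
    (x : EuclideanSpace ℝ (Fin N)) : ℝ := ∑ i, bG u i x ^ 2

lemma bern_sum {N : ℕ} {U : Set (EuclideanSpace ℝ (Fin N))} (hU : IsOpen U)
    {u : EuclideanSpace ℝ (Fin N) → ℝ} (hu : ContDiffOn ℝ 2 u U)
    {x x0 : EuclideanSpace ℝ (Fin N)} {h R k : ℝ} (hx : x ∈ U) (hxh : ∀ i, x + h • bE i ∈ U)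
    (hW : 0 < bW h u x) (hφ : 0 < bPhi x0 R x)
    (hm : IsLocalMax (fun y => bPhi x0 R y ^ k * bW h u y) x) {F : EuclideanSpace ℝ (Fin N) → ℝ}
    (hF : ∀ y ∈ U, ∑ j, bH u j j y = F y) :
    (2 * (∑ j, ∑ i, bD h (bG u j) i x ^ 2 + ∑ i, bD h u i x * bD h F i x)) / bW h u x
      - ∑ j, ((2 * ∑ i, bD h u i x * bD h (bG u j) i x) / bW h u x) ^ 2
      + ∑ j, k * ((-2 / R ^ 2) / bPhi x0 R x
        - ((-2 * (x j - x0 j) / R ^ 2) / bPhi x0 R x) ^ 2) ≤ 0 := by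
  have key := Finset.sum_nonpos fun j (_ : j ∈ Finset.univ) =>
    (bern_line hU hu hx hxh hW hφ hm j).2
  rw [Finset.sum_add_distrib, Finset.sum_sub_distrib] at key
  refine le_of_eq_of_le ?_ key
  congr 2
  rw [← Finset.sum_div, ← Finset.mul_sum]
  congr 2
  simp only [Finset.sum_add_distrib]
  congr 1
  rw [Finset.sum_comm]
  refine Finset.sum_congr rfl fun i _ => ?_
  rw [← Finset.mul_sum]
  congr 1
  simp only [bD, ← Finset.sum_div, Finset.sum_sub_distrib]
  rw [hF _ (hxh i), hF _ hx]

lemma bern_alg {N : ℕ} (hN : 0 < N) {p k R φ W : ℝ} (hp : 1 < p) (hk : 0 < k) (hR : 0 < R)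
    (hφ : 0 < φ) (hφ1 : φ ≤ 1) (hW : 0 < W) (g d : Fin N → ℝ) (H : Fin N → Fin N → ℝ)
    (hWg : W = ∑ i, g i ^ 2) (hd : ∑ i, d i ^ 2 ≤ R ^ 2)
    (hlap : ∑ j, H j j = -W ^ (p / 2))
    (L1 : ∀ j, (2 * ∑ i, g i * H i j) / W + k * ((-2 * d j / R ^ 2) / φ) = 0)
    (L2 : (2 * (∑ j, ∑ i, H i j ^ 2
        + ∑ i, g i * (-(p / 2 * W ^ (p / 2 - 1) * (2 * ∑ j, g j * H j i))))) / W
      - ∑ j, ((2 * ∑ i, g i * H i j) / W) ^ 2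
      + ∑ j, k * ((-2 / R ^ 2) / φ - ((-2 * d j / R ^ 2) / φ) ^ 2) ≤ 0) :
    W ^ ((p - 1) / 2) * φ ≤ (1 + N * p * k + N * (4 * k ^ 2 + 4 * k + 2 * k * N) / 2) / R := by
  have hN' : (0:ℝ) < N := by exact_mod_cast hN
  set a : Fin N → ℝ := fun j => 2 * ∑ i, g i * H i j with ha
  have ha' : ∀ j, a j / W = k * (2 * d j / (R ^ 2 * φ)) := by
    intro j
    have := L1 j
    have e : k * ((-2 * d j / R ^ 2) / φ) = - (k * (2 * d j / (R ^ 2 * φ))) := by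
      field_simp
    rw [e] at this
    change a j / W + _ = 0 at this
    linarith
  have hc : ∑ j, (2 * d j / (R ^ 2 * φ)) ^ 2 ≤ 4 / (R ^ 2 * φ ^ 2) := by
    have : ∑ j, (2 * d j / (R ^ 2 * φ)) ^ 2 = 4 / (R ^ 4 * φ ^ 2) * ∑ j, d j ^ 2 := by
      rw [Finset.mul_sum]
      refine Finset.sum_congr rfl fun j _ => ?_
      field_simp
      ring
    rw [this]
    calc _ ≤ 4 / (R ^ 4 * φ ^ 2) * R ^ 2 := by gcongr
      _ = _ := by field_simp
  refine bern_final (D := ∑ i, g i * a i) hN' hp hk hR hφ hW (by positivity) ?_ ?_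
  · have e : ∑ i, g i * a i = 2 * k * W / (R ^ 2 * φ) * ∑ i, g i * d i := by
      rw [Finset.mul_sum]
      refine Finset.sum_congr rfl fun i _ => ?_
      have := ha' i
      rw [div_eq_iff hW.ne'] at this
      rw [this]; field_simp
    have cs : ∑ i, g i * d i ≤ W ^ (1 / 2 : ℝ) * R := by
      refine (Real.sum_mul_le_sqrt_mul_sqrt Finset.univ g d).trans ?_
      rw [← hWg, ← Real.sqrt_eq_rpow]
      gcongr
      exact Real.sqrt_le_iff.2 ⟨hR.le, hd⟩
    rw [e]
    calc _ ≤ 2 * k * W / (R ^ 2 * φ) * (W ^ (1 / 2 : ℝ) * R) := by gcongr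
      _ = _ := by field_simp
  · have hH : W ^ p ≤ N * ∑ j, ∑ i, H i j ^ 2 := by
      have h1 : (∑ j, H j j) ^ 2 ≤ N * ∑ j, H j j ^ 2 := by
        simpa using sq_sum_le_card_mul_sum_sq (s := Finset.univ) (f := fun j => H j j)
      have h2 : ∑ j, H j j ^ 2 ≤ ∑ j, ∑ i, H i j ^ 2 := by
        refine Finset.sum_le_sum fun j _ => ?_
        exact Finset.single_le_sum (f := fun i => H i j ^ 2) (fun i _ => sq_nonneg _)
          (Finset.mem_univ j)
      have h3 : (∑ j, H j j) ^ 2 = W ^ p := by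
        rw [hlap, neg_sq, ← Real.rpow_natCast, ← Real.rpow_mul hW.le]
        congr 1; push_cast; ring
      rw [← h3]
      exact h1.trans (by gcongr)
    have e1 : ∑ i, g i * (-(p / 2 * W ^ (p / 2 - 1) * (2 * ∑ j, g j * H j i)))
        = - (p / 2 * W ^ (p / 2 - 1) * ∑ i, g i * a i) := by
      rw [Finset.mul_sum, ← Finset.sum_neg_distrib]
      refine Finset.sum_congr rfl fun i _ => ?_
      simp only [ha]; ring
    have e2 : ∑ j, ((2 * ∑ i, g i * H i j) / W) ^ 2
        = k ^ 2 * ∑ j, (2 * d j / (R ^ 2 * φ)) ^ 2 := by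
      rw [Finset.mul_sum]
      refine Finset.sum_congr rfl fun j _ => ?_
      change (a j / W) ^ 2 = _
      rw [ha' j]; ring
    have e3 : ∑ j, k * ((-2 / R ^ 2) / φ - ((-2 * d j / R ^ 2) / φ) ^ 2)
        = - (N * (k * (2 / (R ^ 2 * φ)))) - k * ∑ j, (2 * d j / (R ^ 2 * φ)) ^ 2 := by
      have : ∀ j, k * ((-2 / R ^ 2) / φ - ((-2 * d j / R ^ 2) / φ) ^ 2)
        = - (k * (2 / (R ^ 2 * φ))) - k * (2 * d j / (R ^ 2 * φ)) ^ 2 := by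
        intro j; field_simp
      simp only [this, Finset.sum_sub_distrib, Finset.mul_sum]
      simp
    rw [e1, e2, e3] at L2
    set S := ∑ j, (2 * d j / (R ^ 2 * φ)) ^ 2
    set T := ∑ j, ∑ i, H i j ^ 2
    set D := p / 2 * W ^ (p / 2 - 1) * ∑ i, g i * a i
    have c1 : 2 / N * W ^ p / W ≤ 2 * T / W := by
      refine div_le_div_of_nonneg_right ?_ hW.le
      rw [div_mul_eq_mul_div, div_le_iff₀ hN']
      linarith
    have c2 : 1 / (R ^ 2 * φ) ≤ 1 / (R ^ 2 * φ ^ 2) := by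
      apply one_div_le_one_div_of_le (by positivity)
      have : φ ^ 2 ≤ φ := by nlinarith
      gcongr
    have c3 : k ^ 2 * S ≤ k ^ 2 * (4 / (R ^ 2 * φ ^ 2)) := by gcongr
    have c4 : k * S ≤ k * (4 / (R ^ 2 * φ ^ 2)) := by gcongr
    have c5 : N * (k * (2 / (R ^ 2 * φ))) ≤ 2 * k * N * (1 / (R ^ 2 * φ ^ 2)) := by
      calc _ = 2 * k * N * (1 / (R ^ 2 * φ)) := by ring
        _ ≤ _ := by gcongr
    have c6 : (4 * k ^ 2 + 4 * k + 2 * k * N) / (R ^ 2 * φ ^ 2) = k ^ 2 * (4 / (R ^ 2 * φ ^ 2))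
      + k * (4 / (R ^ 2 * φ ^ 2)) + 2 * k * N * (1 / (R ^ 2 * φ ^ 2)) := by ring
    have c7 : 2 * (T + -D) / W = 2 * T / W - 2 * D / W := by ring
    rw [c7] at L2
    rw [c6]
    linarith

lemma bW0_hasFDerivAt {N : ℕ} {u : EuclideanSpace ℝ (Fin N) → ℝ} {x : EuclideanSpace ℝ (Fin N)}
    (hu : ContDiffAt ℝ 2 u x) : ContDiffAt ℝ 1 (bW0 u) x ∧
      ∀ i, fderiv ℝ (bW0 u) x (bE i) = 2 * ∑ j, bG u j x * bH u j i x := by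
  constructor
  · unfold bW0
    exact ContDiffAt.sum fun j _ => (bG_contDiffAt hu j).pow 2
  · intro i
    have : HasFDerivAt (bW0 u) _ x := HasFDerivAt.fun_sum (u := Finset.univ) fun j _ =>
      (((bG_contDiffAt hu j).differentiableAt (by norm_num)).hasFDerivAt).pow 2
    rw [this.fderiv, ContinuousLinearMap.sum_apply, Finset.mul_sum]
    refine Finset.sum_congr rfl fun j _ => ?_
    rw [bH_symm hu j i]
    simp [bH]
    ring

lemma bern_core {N : ℕ} (hN : 0 < N) {p k : ℝ} (hp : 1 < p) (hk : k = 2 / (p - 1))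
    {U : Set (EuclideanSpace ℝ (Fin N))} (hU : IsOpen U)
    {u : EuclideanSpace ℝ (Fin N) → ℝ} (hu : ContDiffOn ℝ 2 u U)
    (hpde : ∀ y ∈ U, ∑ j, bH u j j y = -bW0 u y ^ (p / 2))
    {x0 : EuclideanSpace ℝ (Fin N)} {R : ℝ} (hR : 0 < R)
    (hB : Metric.closedBall x0 (2 * R) ⊆ U) (hpos : 0 < bW0 u x0) :
    bW0 u x0 ^ ((p - 1) / 2) ≤
      (1 + N * p * k + N * (4 * k ^ 2 + 4 * k + 2 * k * N) / 2) / R := by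
  have hp1 : 0 < p - 1 := by linarith
  have hk0 : 0 < k := by rw [hk]; positivity
  have hcd : ∀ y ∈ U, ContDiffAt ℝ 2 u y := fun y hy => hu.contDiffAt (hU.mem_nhds hy)
  have hB1 : Metric.closedBall x0 R ⊆ U :=
    (Metric.closedBall_subset_closedBall (by linarith)).trans hB
  have hshift : ∀ h : ℝ, 0 < h → h ≤ R → ∀ x ∈ Metric.closedBall x0 R, ∀ i, x + h • bE i ∈ U := by
    intro h h0 h1 x hx i
    apply hB
    rw [Metric.mem_closedBall, dist_eq_norm] at hx ⊢
    have e : x + h • bE i - x0 = (x - x0) + h • bE i := by abel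
    rw [e]
    refine (norm_add_le _ _).trans ?_
    have : ‖h • bE i‖ = h := by rw [norm_smul]; simp [abs_of_pos h0]
    linarith
  have hphic : Continuous (bPhi x0 R) := by unfold bPhi; fun_prop
  have hphi0 : bPhi x0 R x0 = 1 := by simp [bPhi]
  have hphinn : ∀ x ∈ Metric.closedBall x0 R, 0 ≤ bPhi x0 R x := by
    intro x hx
    rw [Metric.mem_closedBall, dist_eq_norm] at hx
    unfold bPhi
    rw [sub_nonneg, div_le_one (by positivity)]
    gcongr
  have hcont : ∀ h : ℝ, 0 < h → h ≤ R →
      ContinuousOn (fun y => bPhi x0 R y ^ k * bW h u y) (Metric.closedBall x0 R) := by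
    intro h h0 h1
    refine ContinuousOn.mul (ContinuousOn.rpow_const hphic.continuousOn fun _ _ => Or.inr hk0.le) ?_
    unfold bW bD
    refine continuousOn_finsetSum _ fun i _ => ?_
    refine ContinuousOn.pow (ContinuousOn.div_const (ContinuousOn.sub ?_ ?_) _) 2
    · exact hu.continuousOn.comp (by fun_prop) fun x hx => hshift h h0 h1 x hx i
    · exact hu.continuousOn.mono hB1
  let h : ℕ → ℝ := fun m => R / ((m : ℝ) + 1)
  have hh0 : ∀ m, 0 < h m := fun m => by positivity
  have hhR : ∀ m, h m ≤ R := fun m => div_le_self hR.le (by linarith [m.cast_nonneg (α := ℝ)])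
  have hhl : Tendsto h atTop (𝓝 0) := by
    have := (tendsto_one_div_add_atTop_nhds_zero_nat (𝕜 := ℝ)).const_mul R
    simpa [h, div_eq_mul_inv] using this
  have hex : ∀ m, ∃ y ∈ Metric.closedBall x0 R,
      IsMaxOn (fun y => bPhi x0 R y ^ k * bW (h m) u y) (Metric.closedBall x0 R) y := fun m =>
    (isCompact_closedBall x0 R).exists_isMaxOn ⟨x0, Metric.mem_closedBall_self hR.le⟩
      (hcont _ (hh0 m) (hhR m))
  choose y hyB hymax using hex
  obtain ⟨s, hsB, ψ, hψ, hlim⟩ := (isCompact_closedBall x0 R).tendsto_subseq hyB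
  have hhl' : Tendsto (h ∘ ψ) atTop (𝓝 0) := hhl.comp hψ.tendsto_atTop
  have hsU := hB1 hsB
  have hD : ∀ (v : EuclideanSpace ℝ (Fin N) → ℝ), ContDiffAt ℝ 1 v s → ∀ i,
      Tendsto (fun m => bD (h (ψ m)) v i (y (ψ m))) atTop (𝓝 (fderiv ℝ v s (bE i))) :=
    fun v hv i => bern_dq (hv.hasStrictFDerivAt (by norm_num)) hlim hhl' (fun m => hh0 _) (bE i)
  have hx0U : x0 ∈ U := hB1 (Metric.mem_closedBall_self hR.le)
  have hWs : Tendsto (fun m => bW (h (ψ m)) u (y (ψ m))) atTop (𝓝 (bW0 u s)) :=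
    tendsto_finsetSum _ fun i _ => (hD u ((hcd s hsU).of_le (by norm_num)) i).pow 2
  have hWx0 : Tendsto (fun m => bW (h (ψ m)) u x0) atTop (𝓝 (bW0 u x0)) :=
    tendsto_finsetSum _ fun i _ => (bern_dq ((hcd x0 hx0U).hasStrictFDerivAt (by norm_num))
      tendsto_const_nhds hhl' (fun m => hh0 _) (bE i)).pow 2
  have hphis : Tendsto (fun m => bPhi x0 R (y (ψ m))) atTop (𝓝 (bPhi x0 R s)) :=
    (hphic.tendsto s).comp hlim
  have hmax : bW0 u x0 ≤ bPhi x0 R s ^ k * bW0 u s := by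
    refine le_of_tendsto_of_tendsto' hWx0 ((hphis.rpow_const (Or.inr hk0.le)).mul hWs) fun m => ?_
    have := hymax (ψ m) (Metric.mem_closedBall_self hR.le)
    simpa [hphi0] using this
  have hφs : 0 < bPhi x0 R s := by
    refine lt_of_le_of_ne (hphinn s hsB) fun e => ?_
    rw [← e, Real.zero_rpow hk0.ne'] at hmax
    linarith
  have hWpos : 0 < bW0 u s := by
    have : 0 < bPhi x0 R s ^ k := Real.rpow_pos_of_pos hφs k
    by_contra hc
    push Not at hc
    nlinarith
  have hev : ∀ᶠ m in atTop, 0 < bW (h (ψ m)) u (y (ψ m)) ∧ 0 < bPhi x0 R (y (ψ m)) ∧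
      IsLocalMax (fun z => bPhi x0 R z ^ k * bW (h (ψ m)) u z) (y (ψ m)) := by
    filter_upwards [hWs.eventually (lt_mem_nhds hWpos), hphis.eventually (lt_mem_nhds hφs)]
      with m a b
    refine ⟨a, b, (hymax (ψ m)).isLocalMax ?_⟩
    refine Filter.mem_of_superset (Metric.isOpen_ball.mem_nhds ?_) Metric.ball_subset_closedBall
    rw [Metric.mem_ball, dist_eq_norm]
    unfold bPhi at b
    rw [sub_pos, div_lt_one (by positivity)] at b
    exact lt_of_pow_lt_pow_left₀ 2 hR.le b
  have hFcd : ContDiffAt ℝ 1 (fun z => -bW0 u z ^ (p / 2)) s :=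
    ((bW0_hasFDerivAt (hcd s hsU)).1.rpow_const_of_ne hWpos.ne').neg
  have hFd : ∀ i, fderiv ℝ (fun z => -bW0 u z ^ (p / 2)) s (bE i) =
      -(p / 2 * bW0 u s ^ (p / 2 - 1) * (2 * ∑ j, bG u j s * bH u j i s)) := by
    intro i
    have h1 := (((bW0_hasFDerivAt (hcd s hsU)).1.differentiableAt (by norm_num)).hasFDerivAt.rpow_const
      (p := p / 2) (Or.inl hWpos.ne')).fun_neg
    rw [h1.fderiv, ← (bW0_hasFDerivAt (hcd s hsU)).2 i]
    simp
  have hcoord : ∀ j, Tendsto (fun m => (y (ψ m)) j - x0 j) atTop (𝓝 (s j - x0 j)) := by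
    intro j
    have : Continuous fun z : EuclideanSpace ℝ (Fin N) => z j - x0 j := by fun_prop
    exact (this.tendsto s).comp hlim
  have hDG : ∀ i j, Tendsto (fun m => bD (h (ψ m)) (bG u j) i (y (ψ m))) atTop
      (𝓝 (bH u i j s)) := fun i j => hD _ (bG_contDiffAt (hcd s hsU) j) i
  have hDu : ∀ i, Tendsto (fun m => bD (h (ψ m)) u i (y (ψ m))) atTop
      (𝓝 (bG u i s)) := fun i => hD _ ((hcd s hsU).of_le (by norm_num)) i
  have hA : ∀ j, Tendsto (fun m => (2 * ∑ i, bD (h (ψ m)) u i (y (ψ m)) *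
      bD (h (ψ m)) (bG u j) i (y (ψ m))) / bW (h (ψ m)) u (y (ψ m))) atTop
      (𝓝 ((2 * ∑ i, bG u i s * bH u i j s) / bW0 u s)) := fun j =>
    ((tendsto_finsetSum _ fun i _ => (hDu i).mul (hDG i j)).const_mul 2).div hWs hWpos.ne'
  have hC : ∀ j, Tendsto (fun m => (-2 * ((y (ψ m)) j - x0 j) / R ^ 2) / bPhi x0 R (y (ψ m))) atTop
      (𝓝 ((-2 * (s j - x0 j) / R ^ 2) / bPhi x0 R s)) := fun j =>
    (((hcoord j).const_mul (-2)).div_const _).div hphis hφs.ne'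
  have L1 : ∀ j, (2 * ∑ i, bG u i s * bH u i j s) / bW0 u s
      + k * ((-2 * (s j - x0 j) / R ^ 2) / bPhi x0 R s) = 0 := by
    intro j
    refine tendsto_nhds_unique ((hA j).add ((hC j).const_mul k)) ?_
    refine tendsto_const_nhds.congr' ?_
    filter_upwards [hev] with m ⟨a, b, c⟩
    exact (bern_line hU hu (hB1 (hyB _)) (hshift _ (hh0 _) (hhR _) _ (hyB _)) a b c j).1.symm
  have L2 : (2 * (∑ j, ∑ i, bH u i j s ^ 2
        + ∑ i, bG u i s * (-(p / 2 * bW0 u s ^ (p / 2 - 1) * (2 * ∑ j, bG u j s * bH u j i s)))))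
          / bW0 u s
      - ∑ j, ((2 * ∑ i, bG u i s * bH u i j s) / bW0 u s) ^ 2
      + ∑ j, k * ((-2 / R ^ 2) / bPhi x0 R s
        - ((-2 * (s j - x0 j) / R ^ 2) / bPhi x0 R s) ^ 2) ≤ 0 := by
    have t1 : Tendsto (fun m => ∑ j, ∑ i, bD (h (ψ m)) (bG u j) i (y (ψ m)) ^ 2) atTop
        (𝓝 (∑ j, ∑ i, bH u i j s ^ 2)) :=
      tendsto_finsetSum _ fun j _ => tendsto_finsetSum _ fun i _ => (hDG i j).pow 2
    have t2 : Tendsto (fun m => ∑ i, bD (h (ψ m)) u i (y (ψ m)) *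
        bD (h (ψ m)) (fun z => -bW0 u z ^ (p / 2)) i (y (ψ m))) atTop
        (𝓝 (∑ i, bG u i s *
          (-(p / 2 * bW0 u s ^ (p / 2 - 1) * (2 * ∑ j, bG u j s * bH u j i s))))) :=
      tendsto_finsetSum _ fun i _ => (hDu i).mul (hFd i ▸ hD _ hFcd i)
    have t3 := tendsto_finsetSum Finset.univ fun j _ => (hA j).pow 2
    have t4 := tendsto_finsetSum Finset.univ fun j _ =>
      (((tendsto_const_nhds (x := -2 / R ^ 2)).div hphis hφs.ne').sub ((hC j).pow 2)).const_mul k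
    refine le_of_tendsto (((((t1.add t2).const_mul 2).div hWs hWpos.ne').sub t3).add t4) ?_
    filter_upwards [hev] with m ⟨a, b, c⟩
    exact bern_sum hU hu (hB1 (hyB _)) (hshift _ (hh0 _) (hhR _) _ (hyB _)) a b c hpde
  have hd : ∑ i, (s i - x0 i) ^ 2 ≤ R ^ 2 := by
    have h1 : ‖s - x0‖ ^ 2 = ∑ i, (s i - x0 i) ^ 2 := by
      rw [EuclideanSpace.real_norm_sq_eq]; simp
    rw [← h1]
    rw [Metric.mem_closedBall, dist_eq_norm] at hsB
    gcongr
  have hφ1 : bPhi x0 R s ≤ 1 := by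
    unfold bPhi
    have : 0 ≤ ‖s - x0‖ ^ 2 / R ^ 2 := by positivity
    linarith
  have fin := bern_alg hN hp hk0 hR hφs hφ1 hWpos (fun i => bG u i s) (fun i => s i - x0 i)
    (fun i j => bH u i j s) rfl hd (hpde s hsU) L1 L2
  refine le_trans ?_ fin
  calc bW0 u x0 ^ ((p - 1) / 2) ≤ (bPhi x0 R s ^ k * bW0 u s) ^ ((p - 1) / 2) := by gcongr
    _ = bW0 u s ^ ((p - 1) / 2) * bPhi x0 R s := by
      rw [Real.mul_rpow (by positivity) hWpos.le, ← Real.rpow_mul hφs.le, mul_comm]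
      have : k * ((p - 1) / 2) = 1 := by rw [hk]; field_simp
      rw [this, Real.rpow_one]

lemma bW0_eq {N : ℕ} (u : EuclideanSpace ℝ (Fin N) → ℝ) (x : EuclideanSpace ℝ (Fin N)) :
    bW0 u x = ‖gradient u x‖ ^ 2 := by
  rw [EuclideanSpace.real_norm_sq_eq]
  refine Finset.sum_congr rfl fun i _ => ?_
  congr 1
  have : fderiv ℝ u x (bE i) = inner ℝ (gradient u x) (bE i) := by
    rw [← toDual_gradient, InnerProductSpace.toDual_apply_apply]
  rw [bG, this, EuclideanSpace.inner_single_right]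
  simp

lemma bern_lap {N : ℕ} {u : EuclideanSpace ℝ (Fin N) → ℝ} {x : EuclideanSpace ℝ (Fin N)}
    (hu : ContDiffAt ℝ 2 u x) : laplacian u x = ∑ j, bH u j j x := by
  unfold laplacian
  refine Finset.sum_congr rfl fun i _ => ?_
  rw [iteratedFDeriv_two_apply, bH_eq hu]
  simp

end

/-- Bernstein gradient estimate: there is a constant `K > 0` depending only on `p, n`
such that every classical solution of `-Δu = |∇u|^p` in the half-space with zero
boundary data satisfies `|∇u(x)| ≤ K xₙ^{-β}`, where `β = 1/(p-1)`. -/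
theorem bernstein_gradient_estimate (n : ℕ) (p β : ℝ) (hp : 1 < p)
    (hβ : β = 1 / (p - 1)) :
    ∃ K : ℝ, 0 < K ∧
      ∀ u : EuclideanSpace ℝ (Fin (n + 1)) → ℝ,
        ContDiffOn ℝ 2 u (halfSpace n) →
        ContinuousOn u (closure (halfSpace n)) →
        (∀ x ∈ halfSpace n, -laplacian u x = ‖gradient u x‖ ^ p) →
        (∀ x : EuclideanSpace ℝ (Fin (n + 1)), x (Fin.last n) = 0 → u x = 0) →
        ∀ x ∈ halfSpace n, ‖gradient u x‖ ≤ K * x (Fin.last n) ^ (-β) := by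
  have hp1 : 0 < p - 1 := by linarith
  have hβ0 : 0 < β := by rw [hβ]; positivity
  set k : ℝ := 2 / (p - 1) with hk
  have hk0 : 0 < k := by positivity
  set C : ℝ := 1 + ((n + 1 : ℕ) : ℝ) * p * k
    + ((n + 1 : ℕ) : ℝ) * (4 * k ^ 2 + 4 * k + 2 * k * ((n + 1 : ℕ) : ℝ)) / 2 with hC
  have hC0 : 0 < C := by positivity
  refine ⟨(3 * C) ^ β, by positivity, ?_⟩
  intro u hu _ hpde _ x hx
  have hx' : 0 < x (Fin.last n) := hx
  have hU : IsOpen (halfSpace n) := by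
    have : Continuous fun z : EuclideanSpace ℝ (Fin (n + 1)) => z (Fin.last n) := by fun_prop
    exact isOpen_lt continuous_const this
  have hcd : ∀ y ∈ halfSpace n, ContDiffAt ℝ 2 u y := fun y hy => hu.contDiffAt (hU.mem_nhds hy)
  rcases eq_or_lt_of_le (norm_nonneg (gradient u x)) with h0 | h0
  · rw [← h0]; positivity
  have hpde' : ∀ y ∈ halfSpace n, ∑ j, bH u j j y = -bW0 u y ^ (p / 2) := by
    intro y hy
    have := hpde y hy
    rw [bern_lap (hcd y hy)] at this
    rw [bW0_eq, ← Real.rpow_natCast, ← Real.rpow_mul (norm_nonneg _)]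
    have e : ((2 : ℕ) : ℝ) * (p / 2) = p := by push_cast; ring
    rw [e, ← this, neg_neg]
  have hB : Metric.closedBall x (2 * (x (Fin.last n) / 3)) ⊆ halfSpace n := by
    intro y hy
    rw [Metric.mem_closedBall, dist_eq_norm] at hy
    have h1 := (PiLp.norm_apply_le (y - x) (Fin.last n)).trans hy
    rw [Real.norm_eq_abs, abs_le] at h1
    have h2 : (y - x) (Fin.last n) = y (Fin.last n) - x (Fin.last n) := rfl
    rw [h2] at h1
    change 0 < y (Fin.last n)
    linarith [h1.1]
  have key := bern_core (Nat.succ_pos n) hp hk hU hu hpde' (R := x (Fin.last n) / 3)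
    (by positivity) hB (by rw [bW0_eq]; positivity)
  change _ ≤ C / _ at key
  rw [bW0_eq, ← Real.rpow_natCast, ← Real.rpow_mul (norm_nonneg _)] at key
  have e : ((2 : ℕ) : ℝ) * ((p - 1) / 2) = p - 1 := by push_cast; ring
  have e' : C / (x (Fin.last n) / 3) = 3 * C * (x (Fin.last n))⁻¹ := by field_simp
  rw [e, e'] at key
  have fin := Real.rpow_le_rpow (by positivity) key hβ0.le
  have e3 : (p - 1) * β = 1 := by rw [hβ]; field_simp
  rwa [← Real.rpow_mul (norm_nonneg _), e3, Real.rpow_one, Real.mul_rpow (by positivity)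
    (by positivity), Real.inv_rpow hx'.le, ← Real.rpow_neg hx'.le] at fin
end

section
/- Let n ≥ 1 and 1 < p < 2, and set β = 1/(p-1) (so β > 1). Let u ∈ C²(ℝⁿ₊) ∩ C(cl ℝⁿ₊) be a classical solution of -Δu = |∇u|^p in ℝⁿ₊ with u = 0 on ∂ℝⁿ₊. Then there exists ℓ ∈ ℝ such that u(x', xₙ) → ℓ as xₙ → ∞, uniformly with respect to x' ∈ ℝⁿ⁻¹, and there exists a constant C depending only on n and p such that |u(x)| ≤ |ℓ| + C xₙ^{1-β} for all x ∈ ℝⁿ₊. -/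
open Filter Topology

lemma snd_test {g g1 : ℝ → ℝ} {g2 : ℝ} (h1 : ∀ᶠ t in 𝓝 (0:ℝ), HasDerivAt g (g1 t) t)
    (h2 : HasDerivAt g1 g2 0) (hm : IsLocalMax g 0) : g1 0 = 0 ∧ g2 ≤ 0 := by
  have e0 : g1 0 = 0 := hm.hasDerivAt_eq_zero h1.self_of_nhds
  refine ⟨e0, ?_⟩
  by_contra hc
  push Not at hc
  have hd : deriv g =ᶠ[𝓝 0] g1 := h1.mono fun t ht => ht.deriv
  have hdd : deriv (deriv g) 0 = g2 := by rw [hd.deriv_eq]; exact h2.deriv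
  have hmin : IsLocalMin g 0 := isLocalMin_of_deriv_deriv_pos (by rw [hdd]; exact hc)
    (by rw [hd.self_of_nhds]; exact e0) h1.self_of_nhds.continuousAt
  have hconst : g =ᶠ[𝓝 0] fun _ => g 0 := by
    filter_upwards [hm, hmin] with t a b using le_antisymm a b
  have hdz : deriv g =ᶠ[𝓝 0] fun _ => 0 := by
    have := hconst.deriv
    simpa using this
  have : deriv (deriv g) 0 = 0 := by rw [hdz.deriv_eq]; simp
  linarith

lemma line_test {ι : Type*} [Fintype ι] (a b : ι → ℝ → ℝ) (c : ι → ℝ) (z0 y γ : ℝ) (hz0 : 0 < z0)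
    (ha : ∀ i, ∀ᶠ t in 𝓝 (0:ℝ), HasDerivAt (a i) (b i t) t)
    (hb : ∀ i, HasDerivAt (b i) (c i) 0)
    (hm : ∀ᶠ t in 𝓝 (0:ℝ), (∑ i, a i t ^ 2) * (z0 - 2 * t * y - t ^ 2) ^ γ
      ≤ (∑ i, a i 0 ^ 2) * z0 ^ γ) :
    (∑ i, 2 * a i 0 * b i 0 = (∑ i, a i 0 ^ 2) * (γ * (2 * y) / z0)) ∧
    ∑ i, (2 * b i 0 ^ 2 + 2 * a i 0 * c i) ≤
      (∑ i, a i 0 ^ 2) * (γ * (γ + 1) * (4 * y ^ 2) / z0 ^ 2 + 2 * γ / z0) := by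
  set z : ℝ → ℝ := fun t => z0 - 2 * t * y - t ^ 2 with hz
  set W0 := ∑ i, a i 0 ^ 2 with hW0
  have zz : z 0 = z0 := by simp [hz]
  have hzd : ∀ t, HasDerivAt z (-2 * y - 2 * t) t := by
    intro t
    have h1 := ((hasDerivAt_id t).const_mul 2).mul_const y
    have h2 := (hasDerivAt_id t).pow 2
    have := ((hasDerivAt_const t z0).sub h1).sub h2
    refine HasDerivAt.congr_deriv this ?_
    simp
  have hzc : Continuous z := by simp only [hz]; fun_prop
  have hzpos : ∀ᶠ t in 𝓝 (0:ℝ), 0 < z t :=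
    hzc.continuousAt.eventually_const_lt (by rw [zz]; exact hz0)
  set M := W0 * z0 ^ γ with hM
  have key := @snd_test (fun t => (∑ i, a i t ^ 2) - M * z t ^ (-γ))
    (fun t => (∑ i, 2 * a i t * b i t) - M * ((-2 * y - 2 * t) * (-γ) * z t ^ (-γ - 1)))
    ((∑ i, (2 * b i 0 ^ 2 + 2 * a i 0 * c i)) -
      M * ((-2) * (-γ) * z0 ^ (-γ - 1) + (-2 * y) * (-γ) * ((-2 * y) * (-γ - 1) * z0 ^ (-γ - 1 - 1))))
    ?_ ?_ ?_
  · obtain ⟨k1, k2⟩ := key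
    have p1 : M * z0 ^ (-γ - 1) = W0 / z0 := by
      rw [hM, mul_assoc, ← Real.rpow_add hz0, show γ + (-γ - 1) = -1 by ring, Real.rpow_neg_one]; rfl
    have p2 : M * z0 ^ (-γ - 1 - 1) = W0 / z0 ^ 2 := by
      rw [hM, mul_assoc, ← Real.rpow_add hz0, show γ + (-γ - 1 - 1) = -2 by ring,
        Real.rpow_neg hz0.le]; norm_num; rfl
    constructor
    · have : (∑ i, 2 * a i 0 * b i 0) = (M * z0 ^ (-γ - 1)) * (2 * y * γ) := by
        simp only [zz] at k1
        linarith
      rw [this, p1]; ring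
    · have : ∑ i, (2 * b i 0 ^ 2 + 2 * a i 0 * c i) ≤ (M * z0 ^ (-γ - 1)) * (2 * γ) +
        (M * z0 ^ (-γ - 1 - 1)) * (γ * (γ + 1) * (4 * y ^ 2)) := by
        linarith
      rw [p1, p2] at this
      refine this.trans (le_of_eq ?_); ring
  · have ha' : ∀ᶠ t in 𝓝 (0:ℝ), ∀ i, HasDerivAt (a i) (b i t) t := eventually_all.2 ha
    filter_upwards [ha', hzpos] with t h1 h2
    have s1 : HasDerivAt (fun t => ∑ i, a i t ^ 2) (∑ i, 2 * a i t * b i t) t := by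
      refine HasDerivAt.fun_sum fun i _ => ?_
      refine HasDerivAt.congr_deriv ((h1 i).pow 2) ?_
      simp
    exact s1.sub (((hzd t).rpow_const (Or.inl h2.ne')).const_mul M)
  · have s1 : HasDerivAt (fun t => ∑ i, 2 * a i t * b i t) (∑ i, (2 * b i 0 ^ 2 + 2 * a i 0 * c i)) 0 := by
      refine HasDerivAt.fun_sum fun i _ => ?_
      refine HasDerivAt.congr_deriv (((ha i).self_of_nhds.const_mul 2).mul (hb i)) ?_
      ring
    refine s1.sub (HasDerivAt.const_mul M ?_)
    have q1 : HasDerivAt (fun t : ℝ => (-2 * y - 2 * t) * (-γ)) ((-2) * (-γ)) 0 := by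
      have := (((hasDerivAt_id (0:ℝ)).const_mul 2).const_sub (-2 * y)).mul_const (-γ)
      refine HasDerivAt.congr_deriv this ?_
      simp
    have q2 := (hzd 0).rpow_const (p := -γ - 1) (Or.inl (by rw [zz]; exact hz0.ne'))
    refine HasDerivAt.congr_deriv (q1.mul q2) ?_
    simp only [zz]; ring
  · filter_upwards [hm, hzpos] with t h1 h2
    have e : M * z0 ^ (-γ) = W0 := by
      rw [hM, mul_assoc, ← Real.rpow_add hz0]; simp
    have : (∑ i, a i t ^ 2) ≤ M * z t ^ (-γ) := by
      rw [Real.rpow_neg h2.le, ← div_eq_mul_inv, le_div_iff₀ (Real.rpow_pos_of_pos h2 _)]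
      exact h1
    simp only [zz, e]
    rw [← hW0]
    linarith

lemma slope_tendsto {E : Type*} [NormedAddCommGroup E] [NormedSpace ℝ E] {g : E → ℝ} {g' : E →L[ℝ] ℝ}
    {x0 e : E} (hg : HasStrictFDerivAt g g' x0) {x : ℕ → E} {h : ℕ → ℝ}
    (hx : Tendsto x atTop (𝓝 x0)) (hh : Tendsto h atTop (𝓝 0)) (hpos : ∀ j, 0 < h j) :
    Tendsto (fun j => (g (x j + h j • e) - g (x j)) / h j) atTop (𝓝 (g' e)) := by
  have t1 : Tendsto (fun j => (x j + h j • e, x j)) atTop (𝓝 (x0, x0)) := by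
    refine Tendsto.prodMk_nhds ?_ hx
    simpa using hx.add (hh.smul_const e)
  have h1 := hg.isLittleO.comp_tendsto t1
  have h2 : (fun j => (h j • e)) =O[atTop] h := by
    refine Asymptotics.IsBigO.of_bound ‖e‖ (Eventually.of_forall fun j => ?_)
    rw [norm_smul, mul_comm]
  have h3 : (fun j => g (x j + h j • e) - g (x j) - g' (h j • e)) =o[atTop] h := by
    refine Asymptotics.IsLittleO.trans_isBigO ?_ h2
    simpa [Function.comp_def] using h1
  have h4 := h3.tendsto_div_nhds_zero
  have h5 := h4.add_const (g' e)
  rw [zero_add] at h5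
  refine h5.congr fun j => ?_
  have := (hpos j).ne'
  simp only [map_smul, smul_eq_mul]
  field_simp
  ring

set_option maxHeartbeats 2000000 in
lemma bern_alg_s4 {m : ℕ} (hm : 0 < m) (p γ R w z : ℝ) (hp1 : 1 < p) (hγ : γ = 2 / (p - 1))
    (hR : 0 < R) (hw : 0 < w) (hz : 0 < z) (v y F : Fin m → ℝ) (H : Fin m → Fin m → ℝ)
    (hwv : w = ∑ i, v i ^ 2) (hzy : z = R ^ 2 - ∑ k, y k ^ 2)
    (h1 : ∀ k, ∑ i, 2 * v i * H k i = w * (γ * (2 * y k) / z))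
    (h2 : ∑ k, ∑ i, 2 * H k i ^ 2 + ∑ i, 2 * v i * F i ≤
      ∑ k, w * (γ * (γ + 1) * (4 * y k ^ 2) / z ^ 2 + 2 * γ / z))
    (h3 : ∑ k, H k k = - w ^ (p / 2))
    (h4 : ∀ i, F i = -(p / 2 * w ^ (p / 2 - 1) * ∑ k, 2 * v k * H k i)) :
    w * z ^ γ ≤ ((m * (4 * γ * (γ + 1) + 2 * m * γ + 2 * p * γ) + 1) * R) ^ γ := by
  have hp0 : 0 < p - 1 := by linarith
  have hγ0 : 0 < γ := by rw [hγ]; positivity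
  have hmR : (0:ℝ) < m := by exact_mod_cast hm
  set Y := ∑ k, y k ^ 2 with hY
  have hY0 : 0 ≤ Y := Finset.sum_nonneg fun i _ => sq_nonneg _
  have hYR : Y ≤ R ^ 2 := by linarith
  have hzR : z ≤ R ^ 2 := by linarith
  set q := w ^ ((p - 1) / 2) with hq
  have hq0 : 0 < q := Real.rpow_pos_of_pos hw _
  set r := Real.sqrt w with hr
  have hr0 : 0 < r := Real.sqrt_pos.2 hw
  have hrr : r * r = w := Real.mul_self_sqrt hw.le
  have er : r = w ^ ((1:ℝ) / 2) := Real.sqrt_eq_rpow w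
  have e1 : w ^ (p / 2) = q * r := by
    rw [hq, er, ← Real.rpow_add hw]; congr 1; ring
  have e2 : w ^ (p / 2 - 1) * w = q * r := by
    rw [← e1, ← Real.rpow_add_one hw.ne']; congr 1; ring
  -- Cauchy-Schwarz for the trace
  have c1 : (q * r) ^ 2 ≤ m * ∑ k, ∑ i, H k i ^ 2 := by
    have a1 : (∑ k, H k k) ^ 2 ≤ m * ∑ k, H k k ^ 2 := by
      simpa using sq_sum_le_card_mul_sum_sq (s := Finset.univ) (f := fun k => H k k)
    have a2 : ∑ k, H k k ^ 2 ≤ ∑ k, ∑ i, H k i ^ 2 := by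
      refine Finset.sum_le_sum fun k _ => ?_
      exact Finset.single_le_sum (f := fun i => H k i ^ 2) (fun i _ => sq_nonneg _) (Finset.mem_univ k)
    rw [h3, neg_sq, e1] at a1
    nlinarith
  have c2 : ∑ k, v k * y k ≤ r * R := by
    refine le_of_sq_le_sq ?_ (by positivity)
    calc (∑ k, v k * y k) ^ 2 ≤ (∑ k, v k ^ 2) * ∑ k, y k ^ 2 := Finset.sum_mul_sq_le_sq_mul_sq _ _ _
      _ ≤ w * R ^ 2 := by rw [← hwv]; gcongr
      _ = (r * R) ^ 2 := by rw [mul_pow, pow_two r, hrr]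
  have c3 : ∑ i, 2 * v i * F i = - (2 * p * γ * (q * r) / z * ∑ k, v k * y k) := by
    have a1 : ∑ i, 2 * v i * F i = -(p * w ^ (p / 2 - 1)) * ∑ k, v k * ∑ i, 2 * v i * H k i := by
      simp only [h4, Finset.mul_sum]
      simp only [← Finset.sum_neg_distrib, Finset.mul_sum]
      rw [Finset.sum_comm]
      refine Finset.sum_congr rfl fun k _ => Finset.sum_congr rfl fun i _ => ?_
      ring
    rw [a1]
    simp only [h1]
    rw [← e2, Finset.mul_sum, Finset.mul_sum, ← Finset.sum_neg_distrib]
    refine Finset.sum_congr rfl fun k _ => ?_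
    ring
  have c4 : ∑ k, w * (γ * (γ + 1) * (4 * y k ^ 2) / z ^ 2 + 2 * γ / z) =
      w * (4 * γ * (γ + 1) * Y / z ^ 2 + 2 * m * γ / z) := by
    rw [← Finset.mul_sum, Finset.sum_add_distrib, ← Finset.sum_div, ← Finset.mul_sum, ← Finset.mul_sum]
    simp
    left
    ring
  set A := 4 * γ * (γ + 1) + 2 * m * γ with hA
  have hA0 : 0 < A := by positivity
  have c5 : 4 * γ * (γ + 1) * Y / z ^ 2 + 2 * m * γ / z ≤ A * R ^ 2 / z ^ 2 := by
    have a1 : 4 * γ * (γ + 1) * Y / z ^ 2 ≤ 4 * γ * (γ + 1) * R ^ 2 / z ^ 2 := by gcongr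
    have a2 : 2 * m * γ / z ≤ 2 * m * γ * R ^ 2 / z ^ 2 := by
      rw [div_le_div_iff₀ hz (by positivity)]
      have : 2 * m * γ * z ^ 2 = 2 * m * γ * z * z := by ring
      rw [this, mul_assoc _ (R ^ 2), mul_comm (R^2), ← mul_assoc]
      gcongr
    calc _ ≤ _ := add_le_add a1 a2
      _ = _ := by rw [hA]; ring
  set s := q * z / R with hs
  have hs0 : 0 < s := by positivity
  have c6 : 2 / m * s ^ 2 ≤ A + 2 * p * γ * s := by
    have a0 : ∑ k, ∑ i, 2 * H k i ^ 2 = 2 * ∑ k, ∑ i, H k i ^ 2 := by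
      simp only [Finset.mul_sum]
    rw [a0, c3, c4] at h2
    have a1 : 2 / m * (q ^ 2 * w) ≤ 2 * ∑ k, ∑ i, H k i ^ 2 := by
      rw [div_mul_eq_mul_div, div_le_iff₀ hmR, ← hrr]
      linarith
    have a2 : 2 * p * γ * (q * r) / z * ∑ k, v k * y k ≤ 2 * p * γ * (q * w) / z * R := by
      calc _ ≤ 2 * p * γ * (q * r) / z * (r * R) := by gcongr
        _ = _ := by rw [← hrr]; ring
    have a3 := mul_le_mul_of_nonneg_left c5 hw.le
    have a4 : 2 / m * (q ^ 2 * w) ≤ w * (A * R ^ 2 / z ^ 2) + 2 * p * γ * (q * w) / z * R := by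
      linarith
    have a5 : 2 / m * q ^ 2 ≤ A * R ^ 2 / z ^ 2 + 2 * p * γ * q / z * R := by
      refine le_of_mul_le_mul_right ?_ hw
      calc _ = 2 / m * (q ^ 2 * w) := by ring
        _ ≤ _ := a4
        _ = _ := by ring
    have a6 := mul_le_mul_of_nonneg_right a5 (show 0 ≤ z ^ 2 / R ^ 2 by positivity)
    calc _ = 2 / m * q ^ 2 * (z ^ 2 / R ^ 2) := by rw [hs]; ring
      _ ≤ _ := a6
      _ = _ := by rw [hs]; field_simp
  have c7 : s ≤ m * (A + 2 * p * γ) + 1 := by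
    by_contra hc
    push Not at hc
    have hB : 0 < A + 2 * p * γ := by positivity
    have hmB : 0 < m * (A + 2 * p * γ) := by positivity
    have s1 : 1 < s := by linarith
    have b1 : m * (A + 2 * p * γ) * s ≤ s ^ 2 := by nlinarith
    have b2 : 2 * s ^ 2 ≤ m * (A + 2 * p * γ * s) := by
      have := mul_le_mul_of_nonneg_left c6 hmR.le
      calc _ = m * (2 / m * s ^ 2) := by field_simp
        _ ≤ _ := this
    have b3 : A + 2 * p * γ * s ≤ (A + 2 * p * γ) * s := by nlinarith
    have b4 : m * (A + 2 * p * γ * s) ≤ m * ((A + 2 * p * γ) * s) := by gcongr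
    have b5 : 0 < s ^ 2 := by positivity
    linarith
  have c8 : w * z ^ γ = (s * R) ^ γ := by
    have : s * R = q * z := by rw [hs]; field_simp
    rw [this, Real.mul_rpow hq0.le hz.le, hq, ← Real.rpow_mul hw.le]
    have : (p - 1) / 2 * γ = 1 := by rw [hγ]; field_simp
    rw [this, Real.rpow_one]
  rw [c8]
  gcongr

lemma line_deriv {E : Type*} [NormedAddCommGroup E] [NormedSpace ℝ E] {g : E → ℝ} {P e : E} {t : ℝ}
    (hg : DifferentiableAt ℝ g (P + t • e)) :
    HasDerivAt (fun t : ℝ => g (P + t • e)) (fderiv ℝ g (P + t • e) e) t := by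
  have h1 : HasDerivAt (fun t : ℝ => P + t • e) e t := by
    simpa using ((hasDerivAt_id t).smul_const e).const_add P
  exact hg.hasFDerivAt.comp_hasDerivAt t h1

lemma grad_sq {m : ℕ} (u : EuclideanSpace ℝ (Fin m) → ℝ) (x : EuclideanSpace ℝ (Fin m)) :
    ‖gradient u x‖ ^ 2 = ∑ i, fderiv ℝ u x (EuclideanSpace.single i 1) ^ 2 := by
  rw [EuclideanSpace.real_norm_sq_eq]
  refine Finset.sum_congr rfl fun i _ => ?_
  rw [← inner_gradient_left, EuclideanSpace.inner_single_right]
  simp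

lemma isOpen_halfSpace (n : ℕ) : IsOpen (halfSpace n) := by
  have : Continuous fun x : EuclideanSpace ℝ (Fin (n + 1)) => x (Fin.last n) := by fun_prop
  exact isOpen_lt continuous_const this

lemma add_mem_halfSpace {n : ℕ} {x : EuclideanSpace ℝ (Fin (n + 1))} (hx : x ∈ halfSpace n)
    {h : ℝ} (hh : 0 ≤ h) (i : Fin (n + 1)) :
    x + h • EuclideanSpace.single i (1 : ℝ) ∈ halfSpace n := by
  have h0 : 0 < x (Fin.last n) := hx
  have : 0 ≤ h * (EuclideanSpace.single i (1 : ℝ) : EuclideanSpace ℝ (Fin (n + 1))) (Fin.last n) := by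
    refine mul_nonneg hh ?_
    simp only [PiLp.single_apply]
    split_ifs <;> norm_num
  show 0 < (x + h • EuclideanSpace.single i (1 : ℝ) : EuclideanSpace ℝ (Fin (n + 1))) (Fin.last n)
  simp only [PiLp.add_apply, PiLp.smul_apply, smul_eq_mul]
  linarith

section
variable {n : ℕ} {u : EuclideanSpace ℝ (Fin (n + 1)) → ℝ}

lemma reg_two (hu : ContDiffOn ℝ 2 u (halfSpace n)) {x : EuclideanSpace ℝ (Fin (n + 1))}
    (hx : x ∈ halfSpace n) : ContDiffAt ℝ 2 u x :=
  hu.contDiffAt ((isOpen_halfSpace n).mem_nhds hx)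

lemma reg_one (hu : ContDiffOn ℝ 2 u (halfSpace n)) {x : EuclideanSpace ℝ (Fin (n + 1))}
    (hx : x ∈ halfSpace n) (e : EuclideanSpace ℝ (Fin (n + 1))) :
    ContDiffAt ℝ 1 (fun y => fderiv ℝ u y e) x := by
  have := (reg_two hu hx).fderiv_right (m := 1) (by norm_num)
  exact this.clm_apply contDiffAt_const

lemma lap_eq (hu : ContDiffOn ℝ 2 u (halfSpace n)) {x : EuclideanSpace ℝ (Fin (n + 1))}
    (hx : x ∈ halfSpace n) : laplacian u x = ∑ k, fderiv ℝ (fun y => fderiv ℝ u y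
      (EuclideanSpace.single k 1)) x (EuclideanSpace.single k 1) := by
  unfold laplacian
  refine Finset.sum_congr rfl fun k _ => ?_
  rw [iteratedFDeriv_two_apply]
  have h1 : DifferentiableAt ℝ (fderiv ℝ u) x :=
    ((reg_two hu hx).fderiv_right (m := 1) (by norm_num)).differentiableAt (by norm_num)
  have := (h1.hasFDerivAt.clm_apply (hasFDerivAt_const
    (EuclideanSpace.single k (1:ℝ) : EuclideanSpace ℝ (Fin (n + 1))) x)).fderiv
  rw [this]
  simp

/-- Discrete Bernstein inequalities at an interior maximum. -/
lemma discrete_bern (hu : ContDiffOn ℝ 2 u (halfSpace n)) {c x : EuclideanSpace ℝ (Fin (n + 1))}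
    (hx : x ∈ halfSpace n) {R γ h : ℝ} (hh : 0 < h) (hz : 0 < R ^ 2 - ‖x - c‖ ^ 2)
    (hmax : ∀ᶠ y in 𝓝 x,
      (∑ i, ((u (y + h • EuclideanSpace.single i (1:ℝ)) - u y) / h) ^ 2) * (R ^ 2 - ‖y - c‖ ^ 2) ^ γ
      ≤ (∑ i, ((u (x + h • EuclideanSpace.single i (1:ℝ)) - u x) / h) ^ 2)
        * (R ^ 2 - ‖x - c‖ ^ 2) ^ γ)
    (d : Fin (n + 1) → EuclideanSpace ℝ (Fin (n + 1)) → ℝ)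
    (hd : d = fun k y => fderiv ℝ u y (EuclideanSpace.single k 1))
    (k : Fin (n + 1)) :
    (∑ i, 2 * ((u (x + h • EuclideanSpace.single i (1:ℝ)) - u x) / h) *
        ((d k (x + h • EuclideanSpace.single i (1:ℝ)) - d k x) / h) =
      (∑ i, ((u (x + h • EuclideanSpace.single i (1:ℝ)) - u x) / h) ^ 2)
        * (γ * (2 * (x - c) k) / (R ^ 2 - ‖x - c‖ ^ 2))) ∧
    (∑ i, (2 * ((d k (x + h • EuclideanSpace.single i (1:ℝ)) - d k x) / h) ^ 2 +
        2 * ((u (x + h • EuclideanSpace.single i (1:ℝ)) - u x) / h) *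
        ((fderiv ℝ (d k) (x + h • EuclideanSpace.single i (1:ℝ)) (EuclideanSpace.single k 1)
          - fderiv ℝ (d k) x (EuclideanSpace.single k 1)) / h)) ≤
      (∑ i, ((u (x + h • EuclideanSpace.single i (1:ℝ)) - u x) / h) ^ 2)
        * (γ * (γ + 1) * (4 * (x - c) k ^ 2) / (R ^ 2 - ‖x - c‖ ^ 2) ^ 2
          + 2 * γ / (R ^ 2 - ‖x - c‖ ^ 2))) := by
  set e : Fin (n + 1) → EuclideanSpace ℝ (Fin (n + 1)) := fun i => EuclideanSpace.single i (1:ℝ) with he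
  have hgo : ∀ P : EuclideanSpace ℝ (Fin (n + 1)), P ∈ halfSpace n →
      ∀ᶠ t in 𝓝 (0:ℝ), P + t • e k ∈ halfSpace n := by
    intro P hP
    have hc : Continuous fun t : ℝ => P + t • e k := by fun_prop
    refine hc.continuousAt.eventually_mem ((isOpen_halfSpace n).mem_nhds ?_)
    simpa using hP
  have hdu : ∀ P ∈ halfSpace n, DifferentiableAt ℝ u P := fun P hP =>
    (reg_two hu hP).differentiableAt (by norm_num)
  have hdd : ∀ P ∈ halfSpace n, DifferentiableAt ℝ (d k) P := fun P hP => by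
    rw [hd]
    exact (reg_one hu hP _).differentiableAt (by norm_num)
  have key := line_test
    (fun i t => (u (x + h • e i + t • e k) - u (x + t • e k)) / h)
    (fun i t => (d k (x + h • e i + t • e k) - d k (x + t • e k)) / h)
    (fun i => (fderiv ℝ (d k) (x + h • e i) (e k) - fderiv ℝ (d k) x (e k)) / h)
    (R ^ 2 - ‖x - c‖ ^ 2) ((x - c) k) γ hz ?_ ?_ ?_
  · simpa only [zero_smul, add_zero] using key
  · intro i
    filter_upwards [hgo x hx, hgo _ (add_mem_halfSpace hx hh.le i)] with t h1 h2
    have := ((line_deriv (hdu _ h2)).sub (line_deriv (hdu _ h1))).div_const h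
    rw [hd]
    exact this
  · intro i
    have a1 := line_deriv (P := x + h • e i) (e := e k) (t := 0) (g := d k)
      (by simpa using hdd _ (add_mem_halfSpace hx hh.le i))
    have a2 := line_deriv (P := x) (e := e k) (t := 0) (g := d k) (by simpa using hdd _ hx)
    have := (a1.sub a2).div_const h
    simp only [zero_smul, add_zero] at this
    exact this
  · have hc : Tendsto (fun t : ℝ => x + t • e k) (𝓝 0) (𝓝 x) := by
      have hc : Continuous fun t : ℝ => x + t • e k := by fun_prop
      simpa using hc.tendsto 0
    filter_upwards [hc.eventually hmax] with t ht
    have ez : R ^ 2 - ‖x + t • e k - c‖ ^ 2 =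
        R ^ 2 - ‖x - c‖ ^ 2 - 2 * t * (x - c) k - t ^ 2 := by
      have : x + t • e k - c = (x - c) + t • e k := by abel
      rw [this, norm_add_sq_real, inner_smul_right, EuclideanSpace.inner_single_right, norm_smul]
      simp [he]
      ring
    rw [ez] at ht
    simp only [zero_smul, add_zero]
    refine le_trans (le_of_eq ?_) ht
    congr 1
    refine Finset.sum_congr rfl fun i _ => ?_
    rw [add_right_comm]

end

lemma grad_core (n : ℕ) (p γ : ℝ) (hp1 : 1 < p) (hγ : γ = 2 / (p - 1))
    (u : EuclideanSpace ℝ (Fin (n + 1)) → ℝ) (hu : ContDiffOn ℝ 2 u (halfSpace n))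
    (heq : ∀ x ∈ halfSpace n, -laplacian u x = ‖gradient u x‖ ^ p)
    (c : EuclideanSpace ℝ (Fin (n + 1))) (R : ℝ) (hR : 0 < R)
    (hK : Metric.closedBall c R ⊆ halfSpace n) :
    ‖gradient u c‖ ^ 2 * (R ^ 2) ^ γ ≤ ((((n + 1 : ℕ) : ℝ) * (4 * γ * (γ + 1) +
      2 * ((n + 1 : ℕ) : ℝ) * γ + 2 * p * γ) + 1) * R) ^ γ := by
  have hp0 : 0 < p - 1 := by linarith
  have hγ0 : 0 < γ := by rw [hγ]; positivity
  set e : Fin (n + 1) → EuclideanSpace ℝ (Fin (n + 1)) := fun i => EuclideanSpace.single i (1:ℝ) with he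
  set d : Fin (n + 1) → EuclideanSpace ℝ (Fin (n + 1)) → ℝ := fun k y => fderiv ℝ u y (e k) with hd
  set w : EuclideanSpace ℝ (Fin (n + 1)) → ℝ := fun x => ∑ i, d i x ^ 2 with hw
  set z : EuclideanSpace ℝ (Fin (n + 1)) → ℝ := fun x => R ^ 2 - ‖x - c‖ ^ 2 with hz
  set S := ((n + 1 : ℕ) : ℝ) * (4 * γ * (γ + 1) + 2 * ((n + 1 : ℕ) : ℝ) * γ + 2 * p * γ) + 1 with hS
  have hS0 : 0 < S := by positivity
  set K := Metric.closedBall c R with hKdef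
  have hKc : IsCompact K := isCompact_closedBall c R
  have hcK : c ∈ K := Metric.mem_closedBall_self hR.le
  set h : ℕ → ℝ := fun j => 1 / ((j:ℝ) + 1) with hh
  have hpos : ∀ j, 0 < h j := fun j => by simp only [hh]; positivity
  have hlim : Tendsto h atTop (𝓝 0) := tendsto_one_div_add_atTop_nhds_zero_nat
  set W : ℕ → EuclideanSpace ℝ (Fin (n + 1)) → ℝ :=
    fun j x => ∑ i, ((u (x + h j • e i) - u x) / h j) ^ 2 with hW
  have hzc : Continuous z := by simp only [hz]; fun_prop
  have hwx : ∀ x, ‖gradient u x‖ ^ 2 = w x := fun x => grad_sq u x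
  have hzK : ∀ x ∈ K, 0 ≤ z x := by
    intro x hx
    have : ‖x - c‖ ≤ R := by rw [← dist_eq_norm]; exact hx
    have : ‖x - c‖ ^ 2 ≤ R ^ 2 := by gcongr
    simp only [hz]; linarith
  have hucont : ∀ x ∈ halfSpace n, ContinuousAt u x := fun x hx => (reg_two hu hx).continuousAt
  have hGc : ∀ j, ContinuousOn (fun x => W j x * z x ^ γ) K := by
    intro j x hx
    refine ContinuousAt.continuousWithinAt ?_
    refine ContinuousAt.mul ?_ (hzc.continuousAt.rpow_const (Or.inr hγ0.le))
    simp only [hW]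
    refine tendsto_finsetSum _ fun i _ => ?_
    have a1 : ContinuousAt (fun y => u (y + h j • e i)) x :=
      ContinuousAt.comp (f := fun y => y + h j • e i) (g := u)
        (hucont _ (add_mem_halfSpace (hK hx) (hpos j).le i)) (by fun_prop)
    exact ((a1.sub (hucont x (hK hx))).div_const _).pow 2
  choose X0 hX0K hX0max using fun j => hKc.exists_isMaxOn ⟨c, hcK⟩ (hGc j)
  obtain ⟨a, haK, φ, hφ, hXa⟩ := hKc.tendsto_subseq hX0K
  have haΩ := hK haK
  set X : ℕ → EuclideanSpace ℝ (Fin (n + 1)) := X0 ∘ φ with hX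
  set η : ℕ → ℝ := h ∘ φ with hη
  have hηpos : ∀ j, 0 < η j := fun j => hpos _
  have hηlim : Tendsto η atTop (𝓝 0) := hlim.comp hφ.tendsto_atTop
  -- slopes of `u`
  have su : ∀ y ∈ halfSpace n, ∀ Y : ℕ → EuclideanSpace ℝ (Fin (n + 1)), Tendsto Y atTop (𝓝 y) → ∀ i,
      Tendsto (fun j => (u (Y j + η j • e i) - u (Y j)) / η j) atTop (𝓝 (d i y)) := fun y hy Y hY i =>
    slope_tendsto ((reg_two hu hy).hasStrictFDerivAt (by norm_num)) hY hηlim hηpos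
  have sW : ∀ y ∈ halfSpace n, ∀ Y : ℕ → EuclideanSpace ℝ (Fin (n + 1)), Tendsto Y atTop (𝓝 y) →
      Tendsto (fun j => W (φ j) (Y j)) atTop (𝓝 (w y)) := fun y hy Y hY =>
    tendsto_finsetSum _ fun i _ => (su y hy Y hY i).pow 2
  have szX : Tendsto (fun j => z (X j)) atTop (𝓝 (z a)) := (hzc.tendsto a).comp hXa
  have smax : ∀ y ∈ K, w y * z y ^ γ ≤ w a * z a ^ γ := by
    intro y hy
    have t1 := (sW y (hK hy) (fun _ => y) tendsto_const_nhds).mul_const (z y ^ γ)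
    have t2 := (sW a haΩ X hXa).mul (szX.rpow_const (p := γ) (Or.inr hγ0.le))
    exact le_of_tendsto_of_tendsto' t1 t2 fun j => hX0max (φ j) hy
  suffices hmain : w a * z a ^ γ ≤ (S * R) ^ γ by
    have := (smax c hcK).trans hmain
    rw [hwx]
    simpa [hz] using this
  by_cases hnon : w a * z a ^ γ ≤ 0
  · exact hnon.trans (by positivity)
  push Not at hnon
  have hwa0 : 0 ≤ w a := Finset.sum_nonneg fun i _ => sq_nonneg _
  have hwa : 0 < w a := by
    rcases hwa0.eq_or_lt with h0 | h0
    · rw [← h0] at hnon; simp at hnon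
    · exact h0
  have hza : 0 < z a := by
    rcases (hzK a haK).eq_or_lt with h0 | h0
    · rw [← h0, Real.zero_rpow hγ0.ne'] at hnon; simp at hnon
    · exact h0
  have sd : ∀ k i, Tendsto (fun j => (d k (X j + η j • e i) - d k (X j)) / η j) atTop
      (𝓝 (fderiv ℝ (d k) a (e i))) := fun k i =>
    slope_tendsto ((reg_one hu haΩ (e k)).hasStrictFDerivAt (by norm_num)) hXa hηlim hηpos
  -- the right-hand side
  set g : EuclideanSpace ℝ (Fin (n + 1)) → ℝ := fun x => -(w x ^ (p / 2)) with hg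
  have hgx : ∀ x ∈ halfSpace n, ∑ k, fderiv ℝ (d k) x (e k) = g x := by
    intro x hx
    have h1 := heq x hx
    have h2 := lap_eq hu hx
    have h3 : w x ^ (p / 2) = ‖gradient u x‖ ^ p := by
      rw [← hwx, ← Real.rpow_natCast, ← Real.rpow_mul (norm_nonneg _)]
      congr 1; push_cast; ring
    simp only [hg]
    rw [h3, ← h1, neg_neg, h2]
  have hwd := HasStrictFDerivAt.fun_sum (u := Finset.univ) fun (k : Fin (n + 1)) _ =>
    ((reg_one hu haΩ (e k)).hasStrictFDerivAt (by norm_num)).pow 2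
  have hgd := (hwd.rpow_const (p := p / 2) (Or.inl hwa.ne')).neg
  have sg := fun i => slope_tendsto (e := e i) hgd hXa hηlim hηpos
  have hev : ∀ᶠ j in atTop, 0 < z (X j) := szX.eventually_const_lt hza
  have hXΩ : ∀ j, X j ∈ halfSpace n := fun j => hK (hX0K _)
  have hdb : ∀ᶠ j in atTop, ∀ k, _ := hev.mono fun j hj k =>
    discrete_bern hu (c := c) (x := X j) (R := R) (γ := γ) (h := η j) (hXΩ j) (hηpos j) hj (by
      have : ∀ᶠ y in 𝓝 (X j), 0 < z y := hzc.continuousAt.eventually_const_lt hj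
      filter_upwards [this] with y hy
      refine hX0max (φ j) (a := y) ?_
      rw [hKdef, Metric.mem_closedBall, dist_eq_norm]
      refine le_of_sq_le_sq ?_ hR.le
      simp only [hz] at hy; linarith) d rfl k
  have sy : ∀ k, Tendsto (fun j => (X j - c) k) atTop (𝓝 ((a - c) k)) := by
    intro k
    have : Continuous fun x : EuclideanSpace ℝ (Fin (n + 1)) => (x - c) k := by fun_prop
    exact (this.tendsto a).comp hXa
  refine bern_alg_s4 (m := n + 1) (Nat.succ_pos n) p γ R (w a) (z a) hp1 hγ hR hwa hza
    (fun i => d i a) (fun k => (a - c) k) _ (fun k i => fderiv ℝ (d k) a (e i)) rfl ?_ ?_ ?_ (hgx a haΩ)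
    (fun i => rfl)
  · simp only [hz]; rw [EuclideanSpace.real_norm_sq_eq]
  · intro k
    refine tendsto_nhds_unique_of_eventuallyEq
      (tendsto_finsetSum _ fun i _ => ((su a haΩ X hXa i).const_mul 2).mul (sd k i))
      ((sW a haΩ X hXa).mul ((((sy k).const_mul 2).const_mul γ).div szX hza.ne')) ?_
    filter_upwards [hdb] with j hj using (hj k).1
  · have L1 : Tendsto (fun j => ∑ k, ∑ i, 2 * ((d k (X j + η j • e i) - d k (X j)) / η j) ^ 2 +
        ∑ i, 2 * ((u (X j + η j • e i) - u (X j)) / η j) *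
          ((g (X j + η j • e i) - g (X j)) / η j)) atTop _ :=
      (tendsto_finsetSum _ fun k _ => tendsto_finsetSum _ fun i _ =>
        ((sd k i).pow 2).const_mul 2).add
      (tendsto_finsetSum _ fun i _ => ((su a haΩ X hXa i).const_mul 2).mul (sg i))
    have L2 : Tendsto (fun j => ∑ k, W (φ j) (X j) * (γ * (γ + 1) * (4 * (X j - c) k ^ 2) / z (X j) ^ 2
        + 2 * γ / z (X j))) atTop (𝓝 (∑ k, w a * (γ * (γ + 1) * (4 * (a - c) k ^ 2) / z a ^ 2
        + 2 * γ / z a))) :=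
      tendsto_finsetSum _ fun k _ => (sW a haΩ X hXa).mul
        ((((((sy k).pow 2).const_mul 4).const_mul _).div (szX.pow 2) (by positivity)).add
          (tendsto_const_nhds.div szX hza.ne'))
    have L3 := le_of_tendsto_of_tendsto L1 L2 (by
      filter_upwards [hdb] with j hj
      refine le_trans (le_of_eq ?_) (Finset.sum_le_sum fun k _ => (hj k).2)
      simp only [Finset.sum_add_distrib]
      congr 1
      rw [Finset.sum_comm]
      refine Finset.sum_congr rfl fun i _ => ?_
      rw [← Finset.mul_sum, ← Finset.sum_div, Finset.sum_sub_distrib]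
      rw [← hgx _ (hXΩ j), ← hgx _ (add_mem_halfSpace (hXΩ j) (hηpos j).le i)])
    refine le_trans (le_of_eq ?_) L3
    congr 1
    refine Finset.sum_congr rfl fun i _ => ?_
    congr 1
    simp [hw, Finset.mul_sum]
    rfl

lemma grad_bound (n : ℕ) (p β : ℝ) (hp1 : 1 < p) (hβ : β = 1 / (p - 1)) :
    ∃ C : ℝ, 0 < C ∧ ∀ u : EuclideanSpace ℝ (Fin (n + 1)) → ℝ, ContDiffOn ℝ 2 u (halfSpace n) →
      (∀ x ∈ halfSpace n, -laplacian u x = ‖gradient u x‖ ^ p) →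
      ∀ x ∈ halfSpace n, ‖fderiv ℝ u x‖ ≤ C * x (Fin.last n) ^ (-β) := by
  have hp0 : 0 < p - 1 := by linarith
  set γ := 2 / (p - 1) with hγ
  have hγ0 : 0 < γ := by positivity
  have hγβ : γ = 2 * β := by rw [hγ, hβ]; ring
  set S := ((n + 1 : ℕ) : ℝ) * (4 * γ * (γ + 1) + 2 * ((n + 1 : ℕ) : ℝ) * γ + 2 * p * γ) + 1 with hS
  have hS0 : 0 < S := by positivity
  refine ⟨(2 * S) ^ β, by positivity, fun u hu heq x hx => ?_⟩
  have hx0 : 0 < x (Fin.last n) := hx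
  set R := x (Fin.last n) / 2 with hR
  have hR0 : 0 < R := by positivity
  have hK : Metric.closedBall x R ⊆ halfSpace n := by
    intro y hy
    have h1 : ‖y - x‖ ≤ R := by rw [← dist_eq_norm]; exact hy
    have h2 := (PiLp.norm_apply_le (y - x) (Fin.last n)).trans h1
    rw [Real.norm_eq_abs, abs_le] at h2
    have h3 : (y - x) (Fin.last n) = y (Fin.last n) - x (Fin.last n) := rfl
    show 0 < y (Fin.last n)
    linarith [h2.1]
  have key := grad_core n p γ hp1 rfl u hu heq x R hR0 hK
  have hn : ‖fderiv ℝ u x‖ = ‖gradient u x‖ := by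
    rw [← toDual_gradient, LinearIsometryEquiv.norm_map]
  rw [hn]
  refine le_of_sq_le_sq ?_ (by positivity)
  have e1 : ((2 * S) ^ β * x (Fin.last n) ^ (-β)) ^ 2 = (S / R) ^ γ := by
    rw [Real.rpow_neg hx0.le, ← div_eq_mul_inv, ← Real.div_rpow (by positivity) hx0.le,
      ← Real.rpow_natCast, ← Real.rpow_mul (by positivity), hγβ]
    congr 1
    · rw [hR]; field_simp
    · push_cast; ring
  rw [e1]
  have e2 : (S / R) ^ γ * (R ^ 2) ^ γ = (S * R) ^ γ := by
    rw [← Real.mul_rpow (by positivity) (by positivity)]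
    congr 1; field_simp
  have : 0 < (R ^ 2) ^ γ := by positivity
  refine le_of_mul_le_mul_right ?_ this
  rw [e2]; exact key

lemma vert_bound {n : ℕ} {β C : ℝ} (hβ : 1 < β)
    {u : EuclideanSpace ℝ (Fin (n + 1)) → ℝ} (hu : ContDiffOn ℝ 2 u (halfSpace n))
    (hg : ∀ x ∈ halfSpace n, ‖fderiv ℝ u x‖ ≤ C * x (Fin.last n) ^ (-β))
    {x : EuclideanSpace ℝ (Fin (n + 1))} (hx : x ∈ halfSpace n) {t : ℝ} (ht : 0 ≤ t) :
    |u (x + t • EuclideanSpace.single (Fin.last n) (1:ℝ)) - u x| ≤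
      C / (β - 1) * x (Fin.last n) ^ (1 - β) - C / (β - 1) * (x (Fin.last n) + t) ^ (1 - β) := by
  have hx0 : 0 < x (Fin.last n) := hx
  set e : EuclideanSpace ℝ (Fin (n + 1)) := EuclideanSpace.single (Fin.last n) (1:ℝ) with he
  have hb : β - 1 ≠ 0 := by linarith
  set a := x (Fin.last n) with ha
  have hin : ∀ s : ℝ, 0 ≤ s → x + s • e ∈ halfSpace n := fun s hs => add_mem_halfSpace hx hs _
  have hcoord : ∀ s : ℝ, (x + s • e) (Fin.last n) = a + s := by
    intro s; simp [he, ha]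
  have hdu : ∀ s : ℝ, 0 ≤ s → HasDerivAt (fun t : ℝ => u (x + t • e) - u x)
      (fderiv ℝ u (x + s • e) e) s := fun s hs =>
    (line_deriv ((reg_two hu (hin s hs)).differentiableAt (by norm_num))).sub_const _
  set B : ℝ → ℝ := fun s => C / (β - 1) * a ^ (1 - β) - C / (β - 1) * (a + s) ^ (1 - β) with hB
  have hBd : ∀ s : ℝ, 0 ≤ s → HasDerivAt B (C * (a + s) ^ (-β)) s := by
    intro s hs
    have h1 : HasDerivAt (fun s : ℝ => a + s) 1 s := (hasDerivAt_id s).const_add a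
    have h2 := ((h1.rpow_const (p := 1 - β) (Or.inl (by positivity))).const_mul (C / (β - 1))).const_sub
      (C / (β - 1) * a ^ (1 - β))
    refine HasDerivAt.congr_deriv h2 ?_
    rw [show 1 - β - 1 = -β by ring]
    field_simp
    ring
  have key := image_norm_le_of_norm_deriv_right_le_deriv_boundary'
    (f := fun t : ℝ => u (x + t • e) - u x) (f' := fun s => fderiv ℝ u (x + s • e) e) (a := 0) (b := t)
    (B := B) (B' := fun s => C * (a + s) ^ (-β))
    (fun s hs => (hdu s hs.1).continuousAt.continuousWithinAt)
    (fun s hs => (hdu s hs.1).hasDerivWithinAt) (by simp [hB])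
    (fun s hs => (hBd s hs.1).continuousAt.continuousWithinAt)
    (fun s hs => (hBd s hs.1).hasDerivWithinAt)
    (fun s hs => ?_)
  · have := key (Set.right_mem_Icc.2 ht)
    simpa only [Real.norm_eq_abs] using this
  · have h1 := hg _ (hin s hs.1)
    rw [hcoord] at h1
    refine le_trans ?_ h1
    refine (ContinuousLinearMap.le_opNorm _ _).trans ?_
    simp [he]

theorem limit_and_growth_estimate (n : ℕ) (p β : ℝ) (hp1 : 1 < p) (hp2 : p < 2)
    (hβ : β = 1 / (p - 1)) :
    ∃ C : ℝ, 0 < C ∧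
      ∀ u : EuclideanSpace ℝ (Fin (n + 1)) → ℝ,
        ContDiffOn ℝ 2 u (halfSpace n) →
        ContinuousOn u (closure (halfSpace n)) →
        (∀ x ∈ halfSpace n, -laplacian u x = ‖gradient u x‖ ^ p) →
        (∀ x : EuclideanSpace ℝ (Fin (n + 1)), x (Fin.last n) = 0 → u x = 0) →
        ∃ ℓ : ℝ,
          (∀ ε > (0 : ℝ), ∃ T : ℝ, ∀ x ∈ halfSpace n,
            T ≤ x (Fin.last n) → |u x - ℓ| < ε) ∧
          (∀ x ∈ halfSpace n, |u x| ≤ |ℓ| + C * x (Fin.last n) ^ (1 - β)) := by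
  obtain ⟨C, hC, hgr⟩ := grad_bound n p β hp1 hβ
  have hp0 : 0 < p - 1 := by linarith
  have hb1 : 1 < β := by rw [hβ, lt_div_iff₀ hp0]; linarith
  have hb0 : 0 < β - 1 := by linarith
  refine ⟨C / (β - 1), by positivity, fun u hu _ heq _ => ?_⟩
  have hg := hgr u hu heq
  set D := C / (β - 1) with hD
  have hD0 : 0 < D := by positivity
  set e : EuclideanSpace ℝ (Fin (n + 1)) := EuclideanSpace.single (Fin.last n) (1:ℝ) with he
  have hpow : Tendsto (fun s : ℝ => s ^ (1 - β)) atTop (𝓝 0) := by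
    have := tendsto_rpow_neg_atTop hb0
    simpa using this
  have heΩ : e ∈ halfSpace n := by simp [he, halfSpace]
  have hve : ∀ {x}, x ∈ halfSpace n → ∀ {t : ℝ}, 0 ≤ t → |u (x + t • e) - u x| ≤
      D * x (Fin.last n) ^ (1 - β) := by
    intro x hx t ht
    have h0 : 0 < x (Fin.last n) := hx
    refine (vert_bound hb1 hu hg hx ht).trans ?_
    have : 0 ≤ D * (x (Fin.last n) + t) ^ (1 - β) := by positivity
    linarith
  -- convergence along the vertical axis
  obtain ⟨ℓ, hℓ⟩ : ∃ ℓ, Tendsto (fun s : ℝ => u (s • e)) atTop (𝓝 ℓ) := by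
    refine cauchy_map_iff_exists_tendsto.1 ?_
    refine Metric.cauchy_iff.2 ⟨by infer_instance, fun ε hε => ?_⟩
    have h1 : Tendsto (fun s : ℝ => D * s ^ (1 - β)) atTop (𝓝 0) := by simpa using hpow.const_mul D
    obtain ⟨T, hT, hT0⟩ := ((h1.eventually_lt_const (half_pos hε)).and (eventually_gt_atTop 0)).exists
    refine ⟨(fun s : ℝ => u (s • e)) '' Set.Ici T, image_mem_map (Ici_mem_atTop T), ?_⟩
    have hTe : T • e ∈ halfSpace n := by simp [he, halfSpace, hT0]
    have hb : ∀ s ∈ Set.Ici T, dist (u (s • e)) (u (T • e)) < ε / 2 := by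
      intro s hs
      have h2 := hve hTe (sub_nonneg.2 hs)
      rw [← add_smul, add_sub_cancel] at h2
      have h3 : (T • e) (Fin.last n) = T := by simp [he]
      rw [h3] at h2
      rw [Real.dist_eq]; linarith
    rintro _ ⟨s, hs, rfl⟩ _ ⟨t, ht, rfl⟩
    have := dist_triangle_right (u (s • e)) (u (t • e)) (u (T • e))
    have h4 := hb s hs
    have h5 := hb t ht
    show dist (u (s • e)) (u (t • e)) < ε
    linarith
  -- convergence along every vertical line
  have hlimx : ∀ x ∈ halfSpace n, Tendsto (fun t : ℝ => u (x + t • e)) atTop (𝓝 ℓ) := by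
    intro x hx
    have h0 : 0 < x (Fin.last n) := hx
    set a := x (Fin.last n) with ha
    have h1 : Tendsto (fun t : ℝ => u ((a + t) • e)) atTop (𝓝 ℓ) :=
      hℓ.comp (tendsto_atTop_add_const_left _ a tendsto_id)
    have h2 : Tendsto (fun t : ℝ => C * (a + t) ^ (-β) * ‖x - a • e‖) atTop (𝓝 0) := by
      have h3 := (tendsto_rpow_neg_atTop (show 0 < β by linarith)).comp
        (tendsto_atTop_add_const_left atTop a tendsto_id)
      simpa using (h3.const_mul C).mul_const ‖x - a • e‖
    have h4 : Tendsto (fun t : ℝ => u (x + t • e) - u ((a + t) • e)) atTop (𝓝 0) := by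
      refine squeeze_zero_norm' ?_ h2
      filter_upwards [eventually_ge_atTop 0] with t ht
      have hat : 0 < a + t := by linarith
      have hsub : {y : EuclideanSpace ℝ (Fin (n + 1)) | a + t ≤ y (Fin.last n)} ⊆ halfSpace n :=
        fun y hy => lt_of_lt_of_le hat hy
      have hconv : Convex ℝ {y : EuclideanSpace ℝ (Fin (n + 1)) | a + t ≤ y (Fin.last n)} := by
        intro y hy z hz r s hr hs hrs
        have hy' : a + t ≤ y (Fin.last n) := hy
        have hz' : a + t ≤ z (Fin.last n) := hz
        show a + t ≤ (r • y + s • z) (Fin.last n)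
        simp only [PiLp.add_apply, PiLp.smul_apply, smul_eq_mul]
        calc a + t = r * (a + t) + s * (a + t) := by rw [← add_mul, hrs, one_mul]
          _ ≤ _ := by gcongr
      have := hconv.norm_image_sub_le_of_norm_fderiv_le (𝕜 := ℝ) (f := u) (C := C * (a + t) ^ (-β))
        (x := (a + t) • e) (y := x + t • e)
        (fun y hy => (reg_two hu (hsub hy)).differentiableAt (by norm_num))
        (fun y hy => (hg y (hsub hy)).trans (by
          have hy' : a + t ≤ y (Fin.last n) := hy
          refine mul_le_mul_of_nonneg_left ?_ hC.le
          exact Real.rpow_le_rpow_of_nonpos hat hy' (by linarith)))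
        (by simp [he]) (by simp [he, ha])
      refine this.trans (le_of_eq ?_)
      congr 2
      rw [add_smul]; abel
    have h5 := h4.add h1
    simpa using h5
  have hfin : ∀ x ∈ halfSpace n, |u x - ℓ| ≤ D * x (Fin.last n) ^ (1 - β) := by
    intro x hx
    have h1 : Tendsto (fun t : ℝ => |u (x + t • e) - u x|) atTop (𝓝 |ℓ - u x|) :=
      ((hlimx x hx).sub_const _).abs
    rw [abs_sub_comm]
    refine le_of_tendsto h1 ?_
    filter_upwards [eventually_ge_atTop 0] with t ht using hve hx ht
  refine ⟨ℓ, fun ε hε => ?_, fun x hx => ?_⟩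
  · have h1 : Tendsto (fun s : ℝ => D * s ^ (1 - β)) atTop (𝓝 0) := by simpa using hpow.const_mul D
    obtain ⟨T, hT⟩ := eventually_atTop.1 (h1.eventually_lt_const hε)
    exact ⟨T, fun x hx hTx => (hfin x hx).trans_lt (hT _ hTx)⟩
  · have h1 := hfin x hx
    have h2 := abs_sub_abs_le_abs_sub (u x) ℓ
    linarith
end
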